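/- arXiv:2504.14902 — 2 statements merged into one kernel-verified Lean document; each statement's English description precedes it below -/
import Mathlib

section
/- Let ℓ = 4 and let A be an essential hyperplane arrangement in K^4. Then A is tame if there is some H ∈ A such that A∖{H} is tame and A∖{H} is locally free along H. -/
noncomputable section
open Classical MvPolynomial

/-- `pdLE R n M` : the `R`-module `M` has projective dimension at most `n`. -/
def pdLE (R : Type) [CommRing R] : ℕ → (M : Type) → [AddCommGroup M] → [Module R M] → Prop
  | 0, M, _, _ => Module.Projective R M
  | n + 1, M, _, _ => ∃ (ι : Type) (f : (ι →₀ R) →ₗ[R] M),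
      Function.Surjective f ∧ pdLE R n (LinearMap.ker f)

/-- Projective dimension as an element of `ℕ∞`. -/
def pdim (R : Type) [CommRing R] (M : Type) [AddCommGroup M] [Module R M] : ℕ∞ :=
  sInf {n : ℕ∞ | ∃ k : ℕ, pdLE R k M ∧ n = (k : ℕ∞)}

/-- The coordinate ring `S = K[x_1, …, x_ℓ]`. -/
abbrev PS (K : Type) [Field K] (ℓ : ℕ) : Type := MvPolynomial (Fin ℓ) K

/-- The free `S`-module of polynomial differential forms of all degrees, realized as the
exterior algebra over `S` on the free module `S^ℓ` (with `dx_i` the standard basis). -/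
abbrev ExtF (K : Type) [Field K] (ℓ : ℕ) : Type :=
  ExteriorAlgebra (PS K ℓ) (Fin ℓ → PS K ℓ)

variable {K : Type} [Field K] {ℓ : ℕ}

/-- The module `Ω^p_V` of polynomial differential `p`-forms. -/
def formsP (K : Type) [Field K] (ℓ : ℕ) (p : ℕ) : Submodule (PS K ℓ) (ExtF K ℓ) :=
  (LinearMap.range (ExteriorAlgebra.ι (PS K ℓ) :
      (Fin ℓ → PS K ℓ) →ₗ[PS K ℓ] ExtF K ℓ)) ^ p

/-- The defining linear form `α = ∑ c_i x_i` of the hyperplane with coefficient vector `c`. -/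
def linP (c : Fin ℓ → K) : PS K ℓ := ∑ i, MvPolynomial.C (c i) * MvPolynomial.X i

/-- The constant one-form `dα = ∑ c_i dx_i`. -/
def dP (c : Fin ℓ → K) : ExtF K ℓ :=
  ExteriorAlgebra.ι (PS K ℓ) (fun i => MvPolynomial.C (c i))

/-- A central hyperplane arrangement in `K^ℓ`: a finite set of (pairwise non-proportional,
nonzero) coefficient vectors of defining linear forms, each representing the hyperplane
`{x : ∑ c_i x_i = 0}`. -/
structure Arrangement (K : Type) [Field K] (ℓ : ℕ) : Type where
  hyps : Finset (Fin ℓ → K)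
  ne_zero : ∀ c ∈ hyps, c ≠ 0
  nonprop : ∀ c ∈ hyps, ∀ c' ∈ hyps, c ≠ c' → ∀ t : K, c ≠ t • c'

/-- The polynomial model of the module `Ω^p(A,m)` of logarithmic `p`-forms of the
multiarrangement `(A,m)`; it is `Q(A,m)·Ω^p(A,m)`, i.e. the image of `Ω^p(A,m)` under the
degree-shifting isomorphism given by multiplication with `Q(A,m)`, so that
`η = Q(A,m)·ω` ranges over polynomial `p`-forms with `dα_H ∧ η ∈ α_H^{m(H)} Ω^{p+1}_V`
for all `H ∈ A`. -/
def Omega (A : Arrangement K ℓ) (m : (Fin ℓ → K) → ℕ) (p : ℕ) :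
    Submodule (PS K ℓ) (ExtF K ℓ) :=
  formsP K ℓ p ⊓ ⨅ c ∈ A.hyps,
    Submodule.comap (LinearMap.mulLeft (PS K ℓ) (dP c))
      (Submodule.map (LinearMap.lsmul (PS K ℓ) (ExtF K ℓ) (linP c ^ m c))
        (formsP K ℓ (p + 1)))

/-- Tameness of a multiarrangement: `pd_S Ω^p(A,m) ≤ p` for all `0 ≤ p ≤ ℓ`. -/
def TameM (A : Arrangement K ℓ) (m : (Fin ℓ → K) → ℕ) : Prop :=
  ∀ p : ℕ, p ≤ ℓ → pdLE (PS K ℓ) p (Omega A m p)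

/-- Tameness of a simple arrangement (constant multiplicity `1`). -/
def Tame (A : Arrangement K ℓ) : Prop := TameM A (fun _ => 1)

/-- Freeness of a multiarrangement: `Ω^1(A,m)` is a free `S`-module. -/
def FreeM (A : Arrangement K ℓ) (m : (Fin ℓ → K) → ℕ) : Prop :=
  Module.Free (PS K ℓ) (Omega A m 1)

/-- An arrangement is essential when the intersection of its hyperplanes is `{0}`,
equivalently the defining forms span the dual space. -/
def Essential (A : Arrangement K ℓ) : Prop :=
  Submodule.span K (A.hyps : Set (Fin ℓ → K)) = ⊤

/-- The localization `A_x = {H ∈ A : x ∈ H}` of an arrangement at a point `x`. -/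
def locArr (A : Arrangement K ℓ) (x : Fin ℓ → K) : Arrangement K ℓ where
  hyps := A.hyps.filter (fun c => ∑ i, c i * x i = 0)
  ne_zero := fun c hc => A.ne_zero c (Finset.mem_filter.mp hc).1
  nonprop := fun c hc c' hc' =>
    A.nonprop c (Finset.mem_filter.mp hc).1 c' (Finset.mem_filter.mp hc').1

/-- `(A,m)` is locally free along the hyperplane `{x : ∑ (c0)_i x_i = 0}` :
`(A_x, m_x)` is free for every nonzero point `x` of this hyperplane. -/
def LocallyFreeAlong (A : Arrangement K ℓ) (m : (Fin ℓ → K) → ℕ) (c0 : Fin ℓ → K) : Prop :=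
  ∀ x : Fin ℓ → K, x ≠ 0 → (∑ i, c0 i * x i = 0) → FreeM (locArr A x) m

/-- The deletion `A ∖ {H}`. -/
def delArr (A : Arrangement K ℓ) (c0 : Fin ℓ → K) : Arrangement K ℓ where
  hyps := A.hyps.erase c0
  ne_zero := fun c hc => A.ne_zero c (Finset.mem_of_mem_erase hc)
  nonprop := fun c hc c' hc' =>
    A.nonprop c (Finset.mem_of_mem_erase hc) c' (Finset.mem_of_mem_erase hc')

/-- The coefficient vector of the restriction of the linear form `c` to the hyperplane `H`
along the linear identification `e : K^{ℓ-1} ≃ H`. -/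
def restrictForm (e : (Fin (ℓ - 1) → K) →ₗ[K] (Fin ℓ → K)) (c : Fin ℓ → K) :
    Fin (ℓ - 1) → K := fun i => ∑ j, c j * e (Pi.single i 1) j

/-- The linear form on `K^ℓ` with coefficient vector `c`. -/
def dotLin (c : Fin ℓ → K) : (Fin ℓ → K) →ₗ[K] K := ∑ i, c i • LinearMap.proj i

/-- `e` identifies `K^{ℓ-1}` with the hyperplane `ker(α_{c0})`. -/
def IsHypEmbedding (c0 : Fin ℓ → K) (e : (Fin (ℓ - 1) → K) →ₗ[K] (Fin ℓ → K)) : Prop :=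
  Function.Injective e ∧ LinearMap.range e = LinearMap.ker (dotLin c0)

/-- `B` (an arrangement in `K^{ℓ-1}`) represents the restriction `A^H` of `A` to the
hyperplane `H` determined by `c0 ∈ A`, via the identification `e : K^{ℓ-1} ≃ H`:
its hyperplanes are exactly the restrictions to `H` of the hyperplanes of `A ∖ {H}`. -/
def IsRestrictionOf (B : Arrangement K (ℓ - 1)) (A : Arrangement K ℓ) (c0 : Fin ℓ → K)
    (e : (Fin (ℓ - 1) → K) →ₗ[K] (Fin ℓ → K)) : Prop :=
  (∀ c ∈ A.hyps, c ≠ c0 → ∃ c' ∈ B.hyps, ∃ t : K, t ≠ 0 ∧ restrictForm e c = t • c') ∧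
  (∀ c' ∈ B.hyps, ∃ c ∈ A.hyps, c ≠ c0 ∧ ∃ t : K, t ≠ 0 ∧ restrictForm e c = t • c')
/-- The Ziegler multiplicity `m^H` on the restriction: `m^H(X) = #{L ∈ A∖{H} : L ∩ H = X}`. -/
def zieglerMult (A : Arrangement K ℓ) (c0 : Fin ℓ → K)
    (e : (Fin (ℓ - 1) → K) →ₗ[K] (Fin ℓ → K)) (c' : Fin (ℓ - 1) → K) : ℕ :=
  (A.hyps.filter (fun c => c ≠ c0 ∧ ∃ t : K, t ≠ 0 ∧ restrictForm e c = t • c')).card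

/-- The wedge `dx_{i_1} ∧ ⋯ ∧ dx_{i_p}` for a list of indices. -/
def wedgeList (l : List (Fin ℓ)) : ExtF K ℓ :=
  (l.map (fun i => ExteriorAlgebra.ι (PS K ℓ) (Pi.single i (1 : PS K ℓ)))).prod

/-- A polynomial `p`-form is homogeneous of (coefficient) degree `d` if it is a sum of
terms `f · dx_{i_1} ∧ ⋯ ∧ dx_{i_p}` with `f` homogeneous of degree `d`. -/
def IsHomogForm (p d : ℕ) (η : ExtF K ℓ) : Prop :=
  η ∈ AddSubgroup.closure {ξ : ExtF K ℓ | ∃ (f : PS K ℓ) (l : List (Fin ℓ)),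
    f.IsHomogeneous d ∧ l.length = p ∧ ξ = f • wedgeList l}

/-- `|m| = ∑_{H ∈ A} m(H)`. -/
def msum (A : Arrangement K ℓ) (m : (Fin ℓ → K) → ℕ) : ℕ := ∑ c ∈ A.hyps, m c

/-- The multiarrangement `(A,m)` is free with exponents `(d_1, …, d_ℓ)`: the polynomial
model of `Ω^1(A,m)` has a homogeneous basis whose `i`-th member has coefficient degree
`|m| - d_i`. -/
def FreeWithExp (A : Arrangement K ℓ) (m : (Fin ℓ → K) → ℕ) (d : Fin ℓ → ℕ) : Prop :=
  ∃ b : Fin ℓ → ExtF K ℓ,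
    (∀ i, b i ∈ Omega A m 1) ∧
    (∀ i, IsHomogForm 1 (msum A m - d i) (b i)) ∧
    LinearIndependent (PS K ℓ) b ∧
    Omega A m 1 ≤ Submodule.span (PS K ℓ) (Set.range b)

/-- The exponent vector `(d_1, d_2, 0, …, 0)`. -/
def expVec (d1 d2 : ℕ) : Fin ℓ → ℕ := fun i =>
  if (i : ℕ) = 0 then d1 else if (i : ℕ) = 1 then d2 else 0

/-- The localization `A_X` of `A` at the lattice element `X = H ∩ L` corresponding,
via the identification `e` of `H` with `K^{ℓ-1}`, to the hyperplane of `H`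
with coefficient vector `c'`. -/
def locOnRestr (A : Arrangement K ℓ) (e : (Fin (ℓ - 1) → K) →ₗ[K] (Fin ℓ → K))
    (c' : Fin (ℓ - 1) → K) : Arrangement K ℓ where
  hyps := A.hyps.filter (fun c => ∃ t : K, restrictForm e c = t • c')
  ne_zero := fun c hc => A.ne_zero c (Finset.mem_filter.mp hc).1
  nonprop := fun c hc c'' hc'' =>
    A.nonprop c (Finset.mem_filter.mp hc).1 c'' (Finset.mem_filter.mp hc'').1

/-- The multiplicity `m - δ_H`. -/
def mdel (m : (Fin ℓ → K) → ℕ) (c0 : Fin ℓ → K) : (Fin ℓ → K) → ℕ :=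
  fun c => if c = c0 then m c - 1 else m c

/-- `ms` is the Euler multiplicity `m^*` on the restriction `B = A^H` (presented via the
identification `e`): for each `X ∈ A^H` the rank-two localization `(A_X, m_X)` is free
with exponents `(d_1^X, d_2^X, 0, …, 0)` ordered so that `(A_X, m_X - δ_H)` is free with
exponents `(d_1^X - 1, d_2^X, 0, …, 0)`, and `m^*(X) = d_2^X`. -/
def IsEulerMult (A : Arrangement K ℓ) (m : (Fin ℓ → K) → ℕ) (c0 : Fin ℓ → K)
    (e : (Fin (ℓ - 1) → K) →ₗ[K] (Fin ℓ → K)) (B : Arrangement K (ℓ - 1))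
    (ms : (Fin (ℓ - 1) → K) → ℕ) : Prop :=
  ∀ c' ∈ B.hyps, ∃ d1 d2 : ℕ,
    FreeWithExp (locOnRestr A e c') m (expVec d1 d2) ∧
    FreeWithExp (locOnRestr A e c') (mdel m c0) (expVec (d1 - 1) d2) ∧
    ms c' = d2

/-- An arrangement is generic if any `k ≤ ℓ-1` of its hyperplanes intersect in
codimension `k`, i.e. any `≤ ℓ-1` of its defining forms are linearly independent. -/
def GenericArr (A : Arrangement K ℓ) : Prop :=
  ∀ s : Finset (Fin ℓ → K), s ⊆ A.hyps → s.card ≤ ℓ - 1 →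
    LinearIndependent K (fun x : {c // c ∈ s} => (x : Fin ℓ → K))

/-- An arrangement is irreducible if it is not a product of two lower-dimensional
arrangements, i.e. its defining forms cannot be split into two complementary proper
subspaces of the dual space. -/
def IrreducibleArr (A : Arrangement K ℓ) : Prop :=
  ¬ ∃ U1 U2 : Submodule K (Fin ℓ → K), U1 ≠ ⊥ ∧ U2 ≠ ⊥ ∧ U1 ⊓ U2 = ⊥ ∧ U1 ⊔ U2 = ⊤ ∧
      ∀ c ∈ A.hyps, c ∈ U1 ∨ c ∈ U2

/-- The defining polynomial `Q(A,m) = ∏_{H ∈ A} α_H^{m(H)}`. -/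
def Qpoly (A : Arrangement K ℓ) (m : (Fin ℓ → K) → ℕ) : PS K ℓ :=
  ∏ c ∈ A.hyps, linP c ^ m c

section

open CategoryTheory

theorem shortExact_moduleCat_of {R : Type} [CommRing R] {L M N : Type} [AddCommGroup L]
    [Module R L] [AddCommGroup M] [Module R M] [AddCommGroup N] [Module R N]
    {f : L →ₗ[R] M} {g : M →ₗ[R] N} (hf : Function.Injective f) (hfg : Function.Exact f g)
    (hg : Function.Surjective g) :
    (ShortComplex.mk (ModuleCat.ofHom f) (ModuleCat.ofHom g) (by
      ext x; exact hfg.apply_apply_eq_zero x)).ShortExact where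
  exact := by
    rw [ShortComplex.moduleCat_exact_iff]
    intro x hx
    exact (hfg x).mp hx
  mono_f := by
    rw [ModuleCat.mono_iff_injective]
    exact hf
  epi_g := by
    rw [ModuleCat.epi_iff_surjective]
    exact hg

/-- The recursive predicate `pdLE` agrees with the projective dimension bound of Mathlib. -/
theorem pdLE_iff_hasProjectiveDimensionLE (R : Type) [CommRing R] (n : ℕ) :
    ∀ (M : Type) [AddCommGroup M] [Module R M],
      pdLE R n M ↔ HasProjectiveDimensionLE (ModuleCat.of R M) n := by
  induction n with
  | zero =>
    intro M _ _
    rw [← projective_iff_hasProjectiveDimensionLE_zero, ← IsProjective.iff_projective]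
    rfl
  | succ n ih =>
    have key : ∀ (M : Type) [AddCommGroup M] [Module R M] (ι : Type)
        (f : (ι →₀ R) →ₗ[R] M), Function.Surjective f →
        (HasProjectiveDimensionLE (ModuleCat.of R M) (n + 1) ↔
          HasProjectiveDimensionLE (ModuleCat.of R (LinearMap.ker f)) n) := by
      intro M _ _ ι f hf
      refine (shortExact_moduleCat_of (f := (LinearMap.ker f).subtype) Subtype.val_injective
        (LinearMap.exact_subtype_ker_map f) hf).hasProjectiveDimensionLT_X₃_iff n ?_
      exact (IsProjective.iff_projective (ModuleCat.of R (ι →₀ R))).mp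
        (inferInstanceAs (Module.Projective R (ι →₀ R)))
    intro M _ _
    constructor
    · rintro ⟨ι, f, hf, hk⟩
      exact (key M ι f hf).mpr ((ih _).mp hk)
    · intro h
      refine ⟨M, Finsupp.linearCombination R id, ?_, ?_⟩
      · exact Finsupp.linearCombination_id_surjective R M
      · exact (ih _).mpr ((key M M _ (Finsupp.linearCombination_id_surjective R M)).mp h)

section Exact

variable {R : Type} [CommRing R] {L M N : Type} [AddCommGroup L] [Module R L]
  [AddCommGroup M] [Module R M] [AddCommGroup N] [Module R N]
  {f : L →ₗ[R] M} {g : M →ₗ[R] N}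

theorem pdLE_of_exact_left {n : ℕ} (hf : Function.Injective f) (hfg : Function.Exact f g)
    (hg : Function.Surjective g) (hM : pdLE R n M) (hN : pdLE R (n + 1) N) : pdLE R n L := by
  rw [pdLE_iff_hasProjectiveDimensionLE] at *
  exact (shortExact_moduleCat_of hf hfg hg).hasProjectiveDimensionLT_X₁ (n + 1) hM hN

theorem pdLE_of_exact_right {n : ℕ} (hf : Function.Injective f) (hfg : Function.Exact f g)
    (hg : Function.Surjective g) (hL : pdLE R n L) (hM : pdLE R (n + 1) M) :
    pdLE R (n + 1) N := by
  rw [pdLE_iff_hasProjectiveDimensionLE] at *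
  exact (shortExact_moduleCat_of hf hfg hg).hasProjectiveDimensionLT_X₃ (n + 1) hL hM

theorem pdLE_of_exact_middle {n : ℕ} (hf : Function.Injective f) (hfg : Function.Exact f g)
    (hg : Function.Surjective g) (hL : pdLE R n L) (hN : pdLE R n N) : pdLE R n M := by
  rw [pdLE_iff_hasProjectiveDimensionLE] at *
  exact (shortExact_moduleCat_of hf hfg hg).hasProjectiveDimensionLT_X₂ (n + 1) hL hN

theorem pdLE_mono {m n : ℕ} (hmn : m ≤ n) (h : pdLE R m M) : pdLE R n M := by
  rw [pdLE_iff_hasProjectiveDimensionLE] at *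
  exact hasProjectiveDimensionLT_of_ge _ (m + 1) (n + 1) (by omega)

theorem pdLE_of_linearEquiv {n : ℕ} (e : M ≃ₗ[R] N) (h : pdLE R n M) : pdLE R n N := by
  rw [pdLE_iff_hasProjectiveDimensionLE] at *
  exact ModuleCat.hasProjectiveDimensionLE_of_linearEquiv (M := ModuleCat.of R M)
    (N := ModuleCat.of R N) e n

theorem pdLE_of_projective {n : ℕ} [h : Module.Projective R M] : pdLE R n M :=
  pdLE_mono (Nat.zero_le n) h

/-- The kernel of a surjection from a projective module has projective dimension one less. -/
theorem pdLE_ker_of_surjective {n : ℕ} [Module.Projective R M] (hg : Function.Surjective g)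
    (h : pdLE R (n + 1) N) : pdLE R n (LinearMap.ker g) :=
  pdLE_of_exact_left (f := (LinearMap.ker g).subtype) Subtype.val_injective
    (LinearMap.exact_subtype_ker_map g) hg pdLE_of_projective h

end Exact

/-- Projective dimension bounds for all modules transfer along ring isomorphisms. -/
theorem forall_pdLE_of_ringEquiv {R R' : Type} [CommRing R] [CommRing R'] (e : R ≃+* R') {n : ℕ}
    (h : ∀ (M : Type) [AddCommGroup M] [Module R M], pdLE R n M)
    (M : Type) [AddCommGroup M] [Module R' M] : pdLE R' n M := by
  let : Module R M := Module.compHom M (e : R →+* R')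
  have := (pdLE_iff_hasProjectiveDimensionLE R n M).mp (h M)
  rw [pdLE_iff_hasProjectiveDimensionLE]
  let := RingHomInvPair.of_ringEquiv e
  let := RingHomInvPair.symm (RingHomClass.toRingHom e) (RingHomClass.toRingHom e.symm)
  let e' : M ≃ₛₗ[RingHomClass.toRingHom e] M :=
    { AddEquiv.refl M with map_smul' := fun r m => rfl }
  exact ModuleCat.hasProjectiveDimensionLE_of_semiLinearEquiv e (M := ModuleCat.of R M)
    (N := ModuleCat.of R' M) e' n

/-- Any module over a field is free, so the global dimension of a field is zero. -/
theorem pdLE_zero_of_field (K : Type) [Field K] (M : Type) [AddCommGroup M] [Module K M] :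
    pdLE K 0 M :=
  inferInstanceAs (Module.Projective K M)

open TensorProduct in
/-- Extension of scalars to a polynomial ring does not increase the projective dimension. -/
theorem pdLE_polynomial_tensorProduct {R : Type} [CommRing R] {n : ℕ} :
    ∀ (M : Type) [AddCommGroup M] [Module R M], pdLE R n M →
      pdLE (Polynomial R) n (Polynomial R ⊗[R] M) := by
  induction n with
  | zero =>
    intro M _ _ h
    have : Module.Projective R M := h
    exact inferInstanceAs (Module.Projective (Polynomial R) (Polynomial R ⊗[R] M))
  | succ n ih =>
    rintro M _ _ ⟨ι, f, hf, hk⟩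
    have hex := LinearMap.exact_subtype_ker_map f
    refine pdLE_of_exact_right (f := (LinearMap.ker f).subtype.baseChange (Polynomial R))
      (g := f.baseChange (Polynomial R)) ?_ ?_ ?_ (ih _ hk) pdLE_of_projective
    · exact Module.Flat.lTensor_preserves_injective_linearMap (M := Polynomial R) _
        Subtype.val_injective
    · have := lTensor_exact (M := LinearMap.ker f) (N := ι →₀ R) (P := M)
        (f := (LinearMap.ker f).subtype) (g := f) (Polynomial R) (by exact hex) hf
      exact this
    · exact LinearMap.lTensor_surjective (Polynomial R) hf

open TensorProduct in
/-- The characteristic sequence of a module over a polynomial ring raises projective dimension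
by at most one. -/
theorem forall_pdLE_polynomial {R : Type} [CommRing R] {n : ℕ}
    (h : ∀ (M : Type) [AddCommGroup M] [Module R M], pdLE R n M)
    (M : Type) [AddCommGroup M] [Module (Polynomial R) M] : pdLE (Polynomial R) (n + 1) M := by
  let : Module R M := Module.compHom M (Polynomial.C : R →+* Polynomial R)
  have : IsScalarTower R (Polynomial R) M := ⟨fun r p m => by
    rw [Polynomial.smul_eq_C_mul, mul_smul]; rfl⟩
  let x : M →ₗ[R] M := (LinearMap.lsmul (Polynomial R) M Polynomial.X).restrictScalars R
  let g : Polynomial R ⊗[R] M →ₗ[Polynomial R] M :=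
    LinearMap.liftBaseChange (Polynomial R) LinearMap.id
  let f : Polynomial R ⊗[R] M →ₗ[Polynomial R] Polynomial R ⊗[R] M :=
    (Polynomial.X : Polynomial R) • LinearMap.id - x.baseChange (Polynomial R)
  have hf_tmul : ∀ (p : Polynomial R) (m : M), f (p ⊗ₜ m) =
      (Polynomial.X * p) ⊗ₜ m - p ⊗ₜ[R] ((Polynomial.X : Polynomial R) • m) := by
    intro p m
    simp [f, x, TensorProduct.smul_tmul']
  have hg_tmul : ∀ (p : Polynomial R) (m : M), g (p ⊗ₜ m) = p • m := by
    intro p m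
    simp [g]
  have hgf : ∀ z, g (f z) = 0 := by
    intro z
    induction z with
    | zero => simp
    | tmul p m => rw [hf_tmul, map_sub, hg_tmul, hg_tmul, mul_comm, mul_smul, sub_self]
    | add a b ha hb => rw [map_add, map_add, ha, hb, add_zero]
  have hred : ∀ z, z - 1 ⊗ₜ g z ∈ LinearMap.range f := by
    intro z
    induction z with
    | zero => simp
    | tmul p m =>
      rw [hg_tmul]
      induction p using Polynomial.induction_on generalizing m with
      | C a =>
        have : (Polynomial.C a : Polynomial R) ⊗ₜ[R] m = 1 ⊗ₜ (Polynomial.C a • m) := by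
          rw [← mul_one (Polynomial.C a), ← Polynomial.smul_eq_C_mul, TensorProduct.smul_tmul,
            Polynomial.smul_eq_C_mul, mul_one]
          rfl
        rw [this, sub_self]
        exact zero_mem _
      | add p q hp hq =>
        have := add_mem (hp m) (hq m)
        rwa [sub_add_sub_comm, ← TensorProduct.add_tmul, ← TensorProduct.tmul_add,
          ← add_smul] at this
      | monomial k a ih =>
        have h1 := ih ((Polynomial.X : Polynomial R) • m)
        have h2 : f ((Polynomial.C a * Polynomial.X ^ k) ⊗ₜ m) ∈ LinearMap.range f := ⟨_, rfl⟩
        rw [hf_tmul] at h2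
        have h3 := add_mem h1 h2
        rw [← mul_smul] at h3
        have e : Polynomial.C a * Polynomial.X ^ (k + 1) =
            Polynomial.C a * Polynomial.X ^ k * Polynomial.X := by ring
        rw [e]
        rw [mul_comm Polynomial.X] at h3
        convert h3 using 1
        abel
    | add a b ha hb =>
      have := add_mem ha hb
      rwa [sub_add_sub_comm, ← TensorProduct.tmul_add, ← map_add] at this
  have hfinj : Function.Injective f := by
    rw [injective_iff_map_eq_zero]
    intro z hz
    let e := PolynomialModule.polynomialTensorProductLEquivPolynomialModule R M
    have he_tmul : ∀ (p : Polynomial R) (m : M), e (p ⊗ₜ m) = p • PolynomialModule.single R 0 m := by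
      intro p m
      rfl
    have hcoeff : ∀ (w : Polynomial R ⊗[R] M) (k : ℕ),
        (e (f w)).coeff (k + 1) = (e w).coeff k - x ((e w).coeff (k + 1)) := by
      intro w k
      induction w with
      | zero => simp
      | tmul p m =>
        rw [hf_tmul, map_sub, he_tmul, he_tmul, he_tmul]
        have hs : ∀ u v : PolynomialModule R M, (u - v).coeff = u.coeff - v.coeff :=
          fun u v => map_sub (PolynomialModule.coeffLinearEquiv R R) u v
        rw [hs, Finsupp.sub_apply]
        simp only [PolynomialModule.smul_single_apply, Nat.zero_le, if_true, Nat.sub_zero,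
          Polynomial.coeff_X_mul, map_smul]
        rfl
      | add a b ha hb =>
        simp only [map_add, PolynomialModule.coeff_add, Finsupp.add_apply, ha, hb]
        abel
    have hzero : ∀ k, (e z).coeff k = x ((e z).coeff (k + 1)) := by
      intro k
      have := hcoeff z k
      rw [hz, map_zero] at this
      exact (sub_eq_zero.mp this.symm)
    have hall : ∀ d k, (e z).coeff.support.sup id < k + d → (e z).coeff k = 0 := by
      intro d
      induction d with
      | zero =>
        intro k hk
        by_contra hne
        have := Finset.le_sup (f := id) (Finsupp.mem_support_iff.mpr hne)
        simp only [id] at this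
        omega
      | succ d ih =>
        intro k hk
        rw [hzero k, ih (k + 1) (by omega), map_zero]
    have : e z = 0 := by
      apply PolynomialModule.coeff_injective
      ext k
      exact hall ((e z).coeff.support.sup id + 1) k (by omega)
    exact e.map_eq_zero_iff.mp this
  refine pdLE_of_exact_right (f := f) (g := g) hfinj ?_ ?_ (pdLE_polynomial_tensorProduct M (h M))
    (pdLE_mono (Nat.le_succ n) (pdLE_polynomial_tensorProduct M (h M)))
  · intro z
    constructor
    · intro hz
      have := hred z
      rwa [hz, TensorProduct.tmul_zero, sub_zero] at this
    · rintro ⟨w, rfl⟩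
      exact hgf w
  · intro m
    exact ⟨1 ⊗ₜ m, by rw [hg_tmul, one_smul]⟩

/-- Hilbert's syzygy theorem: the global dimension of `K[x_1, …, x_n]` is at most `n`. -/
theorem pdLE_mvPolynomial (K : Type) [Field K] (n : ℕ) :
    ∀ (M : Type) [AddCommGroup M] [Module (PS K n) M], pdLE (PS K n) n M := by
  induction n with
  | zero =>
    exact forall_pdLE_of_ringEquiv (MvPolynomial.isEmptyRingEquiv K (Fin 0)).symm
      (pdLE_zero_of_field K)
  | succ n ih =>
    exact forall_pdLE_of_ringEquiv (MvPolynomial.finSuccEquiv K n).toRingEquiv.symm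
      (forall_pdLE_polynomial ih)

end

/-- The kernel of a map between projective modules over a ring of global dimension at most
`n + 2` has projective dimension at most `n`. -/
theorem pdLE_ker_of_forall_pdLE {R : Type} [CommRing R] {n : ℕ}
    (h : ∀ (M : Type) [AddCommGroup M] [Module R M], pdLE R (n + 2) M)
    {P Q : Type} [AddCommGroup P] [Module R P] [AddCommGroup Q] [Module R Q]
    [Module.Projective R P] [Module.Projective R Q] (f : P →ₗ[R] Q) :
    pdLE R n (LinearMap.ker f) := by
  have h1 : pdLE R (n + 1) (LinearMap.range f) :=
    pdLE_of_exact_left (f := (LinearMap.range f).subtype) (g := (LinearMap.range f).mkQ)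
      Subtype.val_injective
      (by rw [LinearMap.exact_iff, Submodule.ker_mkQ, Submodule.range_subtype])
      (Submodule.mkQ_surjective _) pdLE_of_projective (h _)
  have h2 := pdLE_ker_of_surjective (g := f.rangeRestrict) f.surjective_rangeRestrict h1
  rwa [LinearMap.ker_rangeRestrict] at h2

instance formsP_free (K : Type) [Field K] (ℓ p : ℕ) : Module.Free (PS K ℓ) (formsP K ℓ p) :=
  inferInstanceAs (Module.Free (PS K ℓ) (⋀[PS K ℓ]^p (Fin ℓ → PS K ℓ)))

theorem linP_ne_zero {c : Fin ℓ → K} (hc : c ≠ 0) : linP c ≠ 0 := by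
  obtain ⟨j, hj⟩ := Function.ne_iff.mp hc
  intro h
  have := congrArg (MvPolynomial.eval (Pi.single j (1 : K))) h
  simp [linP, Pi.single_apply] at this
  exact hj this

theorem dP_mul_mem_formsP {c : Fin ℓ → K} {p : ℕ} {η : ExtF K ℓ} (hη : η ∈ formsP K ℓ p) :
    dP c * η ∈ formsP K ℓ (p + 1) := by
  rw [formsP, pow_succ']
  exact Submodule.mul_mem_mul ⟨_, rfl⟩ hη

/-- The modules of logarithmic forms are second syzygies. -/
theorem pdLE_two_Omega (A : Arrangement K 4) (m : (Fin 4 → K) → ℕ) (p : ℕ) :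
    pdLE (PS K 4) 2 (Omega A m p) := by
  let d : A.hyps → (formsP K 4 p →ₗ[PS K 4] formsP K 4 (p + 1)) := fun c =>
    LinearMap.codRestrict _ ((LinearMap.mulLeft (PS K 4) (dP c.1)).comp (formsP K 4 p).subtype)
      (fun η => dP_mul_mem_formsP η.2)
  let f : (formsP K 4 p × (A.hyps → formsP K 4 (p + 1))) →ₗ[PS K 4]
      (A.hyps → formsP K 4 (p + 1)) :=
    LinearMap.pi fun c => (d c).comp (LinearMap.fst _ _ _) -
      (linP c.1 ^ m c.1) • (LinearMap.proj c).comp (LinearMap.snd _ _ _)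
  have hf : ∀ η ξ c, ((f (η, ξ) c : formsP K 4 (p + 1)) : ExtF K 4) =
      dP c.1 * η - (linP c.1 ^ m c.1) • (ξ c : ExtF K 4) := fun η ξ c => rfl
  have hker : ∀ x, f x = 0 ↔ ∀ c : A.hyps, dP c.1 * (x.1 : ExtF K 4) =
      (linP c.1 ^ m c.1) • (x.2 c : ExtF K 4) := by
    intro x
    rw [funext_iff]
    refine forall_congr' fun c => ?_
    rw [Subtype.ext_iff, hf, Pi.zero_apply, ZeroMemClass.coe_zero, sub_eq_zero]
  have hmem : ∀ η : ExtF K 4, η ∈ Omega A m p ↔ η ∈ formsP K 4 p ∧ ∀ c ∈ A.hyps,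
      ∃ ξ ∈ formsP K 4 (p + 1), (linP c ^ m c) • ξ = dP c * η := by
    intro η
    simp [Omega, Submodule.mem_iInf]
  let g : LinearMap.ker f →ₗ[PS K 4] Omega A m p :=
    LinearMap.codRestrict _ ((formsP K 4 p).subtype.comp
      ((LinearMap.fst _ _ _).comp (LinearMap.ker f).subtype)) (fun x => by
        rw [hmem]
        refine ⟨x.1.1.2, fun c hc => ⟨x.1.2 ⟨c, hc⟩, (x.1.2 ⟨c, hc⟩).2, ?_⟩⟩
        exact ((hker x.1).mp x.2 ⟨c, hc⟩).symm)
  have hg : Function.Bijective g := by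
    constructor
    · rw [injective_iff_map_eq_zero]
      rintro ⟨⟨η, ξ⟩, hx⟩ h0
      have h1 : (η : ExtF K 4) = 0 := congrArg Subtype.val h0
      have h2 := (hker _).mp hx
      have h3 : ξ = 0 := by
        funext c
        have h4 := h2 c
        simp only [h1, mul_zero] at h4
        have h5 : (linP c.1 ^ m c.1) • ξ c = 0 := Subtype.ext h4.symm
        exact (smul_eq_zero.mp h5).resolve_left
          (pow_ne_zero _ (linP_ne_zero (A.ne_zero _ c.2)))
      simp only [Submodule.mk_eq_zero, Prod.mk_eq_zero]
      exact ⟨Subtype.ext h1, h3⟩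
    · rintro ⟨η, hη⟩
      obtain ⟨h1, h2⟩ := (hmem η).mp hη
      choose ξ hξ hξ' using h2
      refine ⟨⟨(⟨η, h1⟩, fun c => ⟨ξ c.1 c.2, hξ c.1 c.2⟩), ?_⟩, rfl⟩
      rw [LinearMap.mem_ker, hker]
      exact fun c => (hξ' c.1 c.2).symm
  exact pdLE_of_linearEquiv (LinearEquiv.ofBijective g hg)
    (pdLE_ker_of_forall_pdLE (pdLE_mvPolynomial K 4) f)

open ExteriorAlgebra in
/-- Coordinate description of logarithmic one-forms: `dα ∧ v` is divisible by `α` exactly when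
`v` is proportional to `dα` modulo `α`. -/
theorem dP_mul_ι_eq_smul_iff {c : Fin ℓ → K} (hc : c ≠ 0) (v : Fin ℓ → PS K ℓ) :
    (∃ ξ ∈ formsP K ℓ 2, linP c • ξ = dP c * ι (PS K ℓ) v) ↔
      ∀ i k, linP c ∣ C (c i) * v k - C (c k) * v i := by
  obtain ⟨j, hj⟩ := Function.ne_iff.mp hc
  simp only [Pi.zero_apply] at hj
  constructor
  · rintro ⟨ξ, -, hξ⟩
    let δ : Module.Dual (PS K ℓ) (Fin ℓ → PS K ℓ) :=
      (C (c j)⁻¹ : PS K ℓ) • (LinearMap.proj j : (Fin ℓ → PS K ℓ) →ₗ[PS K ℓ] PS K ℓ)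
    have hδ : δ (fun i => C (c i)) = 1 := by
      simp [δ, ← C_mul, hj]
    have h1 := congrArg (fun z => ιInv (CliffordAlgebra.contractLeft (Q := 0) δ z)) hξ
    have h2 : CliffordAlgebra.contractLeft (Q := 0) δ (dP c * ι (PS K ℓ) v) =
        ι (PS K ℓ) v - δ v • ι (PS K ℓ) (fun i => C (c i)) := by
      have := CliffordAlgebra.contractLeft_ι_mul (Q := (0 : QuadraticForm (PS K ℓ) _)) (d := δ)
        (fun i => C (c i)) (ι (PS K ℓ) v)
      have h3 := CliffordAlgebra.contractLeft_ι (Q := (0 : QuadraticForm (PS K ℓ) _)) (d := δ) v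
      rw [hδ, one_smul] at this
      refine this.trans ?_
      rw [show CliffordAlgebra.contractLeft (Q := 0) δ (ι (PS K ℓ) v) = _ from h3]
      rw [← Algebra.commutes, ← Algebra.smul_def]
    simp only [map_smul, h2, map_sub] at h1
    rw [show ιInv (ι (PS K ℓ) v) = v from ι_leftInverse v,
      show ιInv (ι (PS K ℓ) (fun i => C (c i))) = (fun i => C (c i) : Fin ℓ → PS K ℓ) from
        ι_leftInverse _] at h1
    set w := ιInv (CliffordAlgebra.contractLeft (Q := 0) δ ξ)
    intro i k
    have hi := congrFun h1 i
    have hk := congrFun h1 k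
    simp only [Pi.smul_apply, smul_eq_mul, Pi.sub_apply] at hi hk
    exact ⟨C (c i) * w k - C (c k) * w i, by linear_combination C (c k) * hi - C (c i) * hk⟩
  · intro h
    choose w hw using fun k => h j k
    refine ⟨(C (c j)⁻¹ : PS K ℓ) • (ι (PS K ℓ) (fun i => C (c i)) * ι (PS K ℓ) w), ?_, ?_⟩
    · refine Submodule.smul_mem _ _ ?_
      rw [formsP, pow_two]
      exact Submodule.mul_mem_mul ⟨_, rfl⟩ ⟨_, rfl⟩
    · have hv : v = (C (c j)⁻¹ * v j) • (fun i => C (c i) : Fin ℓ → PS K ℓ) +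
          (C (c j)⁻¹ * linP c) • w := by
        funext k
        simp only [Pi.add_apply, Pi.smul_apply, smul_eq_mul]
        have : (C (c j)⁻¹ * C (c j) : PS K ℓ) = 1 := by rw [← C_mul, inv_mul_cancel₀ hj, C_1]
        linear_combination C (c j)⁻¹ * hw k - v k * this
      conv_rhs => rw [hv]
      rw [map_add, map_smul, map_smul, mul_add, dP, mul_smul_comm, mul_smul_comm, ι_sq_zero,
        smul_zero, zero_add, smul_smul, mul_comm]

/-- Logarithmic one-forms of a simple arrangement in coordinates. -/
def logOneForms (A : Arrangement K ℓ) : Submodule (PS K ℓ) (Fin ℓ → PS K ℓ) where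
  carrier := {v | ∀ c ∈ A.hyps, ∀ i k, linP c ∣ C (c i) * v k - C (c k) * v i}
  zero_mem' := by
    intro c _ i k
    simp
  add_mem' := by
    intro u v hu hv c hc i k
    convert dvd_add (hu c hc i k) (hv c hc i k) using 1
    simp only [Pi.add_apply]
    ring
  smul_mem' := by
    intro r v hv c hc i k
    convert (hv c hc i k).mul_left r using 1
    simp only [Pi.smul_apply, smul_eq_mul]
    ring

theorem mem_logOneForms {A : Arrangement K ℓ} {v : Fin ℓ → PS K ℓ} :
    v ∈ logOneForms A ↔ ∀ c ∈ A.hyps, ∀ i k, linP c ∣ C (c i) * v k - C (c k) * v i :=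
  Iff.rfl

theorem ι_mem_Omega_one {A : Arrangement K ℓ} {v : Fin ℓ → PS K ℓ} :
    ExteriorAlgebra.ι (PS K ℓ) v ∈ Omega A (fun _ => 1) 1 ↔ v ∈ logOneForms A := by
  have h1 : ExteriorAlgebra.ι (PS K ℓ) v ∈ formsP K ℓ 1 := by
    rw [formsP, pow_one]
    exact ⟨v, rfl⟩
  simp only [Omega, Submodule.mem_inf, h1, true_and, Submodule.mem_iInf, Submodule.mem_comap,
    Submodule.mem_map, pow_one, LinearMap.mulLeft_apply, LinearMap.lsmul_apply, mem_logOneForms]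
  exact forall₂_congr fun c hc => dP_mul_ι_eq_smul_iff (A.ne_zero c hc) v

/-- The identification of `Ω^1(A)` with its coordinate description. -/
def logOneFormsEquiv (A : Arrangement K ℓ) :
    logOneForms A ≃ₗ[PS K ℓ] Omega A (fun _ => 1) 1 :=
  LinearEquiv.ofBijective
    (LinearMap.codRestrict _ ((ExteriorAlgebra.ι (PS K ℓ)).comp (logOneForms A).subtype)
      (fun v => ι_mem_Omega_one.mpr v.2)) (by
    constructor
    · intro u v h
      exact Subtype.ext (ExteriorAlgebra.ι_leftInverse.injective (congrArg Subtype.val h))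
    · rintro ⟨η, hη⟩
      have h1 : η ∈ formsP K ℓ 1 := hη.1
      rw [formsP, pow_one] at h1
      obtain ⟨v, rfl⟩ := h1
      exact ⟨⟨v, ι_mem_Omega_one.mp hη⟩, rfl⟩)

/-- The restriction of polynomial functions to the hyperplane `{x : ∑ c_i x_i = 0}`, obtained by
solving for the `j`-th variable. -/
def restrictHyp {n : ℕ} (c : Fin (n + 1) → K) (j : Fin (n + 1)) : PS K (n + 1) →ₐ[K] PS K n :=
  aeval (j.insertNth (-(C (c j)⁻¹ * ∑ i, C (c (j.succAbove i)) * X i) : PS K n) X)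

section

variable {n : ℕ} (c : Fin (n + 1) → K) (j : Fin (n + 1))

@[simp]
theorem restrictHyp_X_self :
    restrictHyp c j (X j) = -(C (c j)⁻¹ * ∑ i, C (c (j.succAbove i)) * X i) := by
  simp [restrictHyp]

@[simp]
theorem restrictHyp_X_succAbove (i : Fin n) : restrictHyp c j (X (j.succAbove i)) = X i := by
  simp [restrictHyp]

@[simp]
theorem restrictHyp_C (a : K) : restrictHyp c j (C a) = C a :=
  (restrictHyp c j).commutes a

theorem restrictHyp_surjective : Function.Surjective (restrictHyp c j) := by
  let σ : PS K n →ₐ[K] PS K (n + 1) := aeval fun i => X (j.succAbove i)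
  have h : (restrictHyp c j).comp σ = AlgHom.id K _ := by
    ext i
    simp [σ]
  exact fun p => ⟨σ p, DFunLike.congr_fun h p⟩

theorem restrictHyp_linP (d : Fin (n + 1) → K) :
    restrictHyp c j (linP d) =
      linP (fun i => d (j.succAbove i) - d j * (c j)⁻¹ * c (j.succAbove i)) := by
  simp only [linP, map_add, map_sum, map_mul, restrictHyp_C, Fin.sum_univ_succAbove _ j,
    restrictHyp_X_self, restrictHyp_X_succAbove, map_sub, sub_mul, Finset.sum_sub_distrib,
    Finset.mul_sum, mul_neg, mul_assoc]
  ring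

variable {c j}

theorem restrictHyp_eq_zero_iff (hj : c j ≠ 0) {f : PS K (n + 1)} :
    restrictHyp c j f = 0 ↔ linP c ∣ f := by
  constructor
  · intro h
    let σ : PS K n →ₐ[K] PS K (n + 1) := aeval fun i => X (j.succAbove i)
    let q : PS K (n + 1) →ₐ[K] PS K (n + 1) ⧸ Ideal.span {linP c} := Ideal.Quotient.mkₐ K _
    have hq : (q.comp σ).comp (restrictHyp c j) = q := by
      apply MvPolynomial.algHom_ext
      intro i
      refine Fin.succAboveCases j ?_ (fun i => ?_) i
      · simp only [AlgHom.comp_apply, restrictHyp_X_self]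
        refine (Ideal.Quotient.eq.mpr (Ideal.mem_span_singleton.mpr ⟨-C (c j)⁻¹, ?_⟩))
        have : (C (c j)⁻¹ * C (c j) : PS K (n + 1)) = 1 := by
          rw [← C_mul, inv_mul_cancel₀ hj, C_1]
        simp only [map_neg, map_mul, map_sum, σ, aeval_X, aeval_C, algebraMap_eq, linP,
          Fin.sum_univ_succAbove _ j]
        linear_combination X j * this
      · simp [σ]
    have h1 := DFunLike.congr_fun hq f
    simp only [AlgHom.comp_apply, h, map_zero] at h1
    exact Ideal.mem_span_singleton.mp (Ideal.Quotient.eq_zero_iff_mem.mp h1.symm)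
  · rintro ⟨g, rfl⟩
    have h0 : restrictHyp c j (linP c) = 0 := by
      rw [restrictHyp_linP]
      simp [hj, linP]
    rw [map_mul, h0, zero_mul]

end

theorem prime_linP {c : Fin ℓ → K} (hc : c ≠ 0) : Prime (linP c) := by
  obtain ⟨j, hj⟩ := Function.ne_iff.mp hc
  obtain _ | n := ℓ
  · exact j.elim0
  refine ⟨linP_ne_zero hc, ?_, ?_⟩
  · intro h
    have := (restrictHyp_eq_zero_iff hj (f := 1)).mpr h.dvd
    simp at this
  · intro a b hab
    rw [← restrictHyp_eq_zero_iff hj, map_mul, mul_eq_zero] at hab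
    simpa only [restrictHyp_eq_zero_iff hj] using hab

theorem exists_eq_smul_of_linP_dvd {c d : Fin ℓ → K} (hc : c ≠ 0) (h : linP c ∣ linP d) :
    ∃ t : K, d = t • c := by
  obtain ⟨j, hj⟩ := Function.ne_iff.mp hc
  obtain _ | n := ℓ
  · exact j.elim0
  rw [← restrictHyp_eq_zero_iff hj, restrictHyp_linP] at h
  have h0 := not_imp_not.mp linP_ne_zero h
  refine ⟨d j * (c j)⁻¹, funext fun i => ?_⟩
  refine Fin.succAboveCases j ?_ (fun i => ?_) i
  · simp only [Pi.zero_apply] at hj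
    simp [hj]
  · simpa [sub_eq_zero] using congrFun h0 i

theorem linP_not_dvd_linP {A : Arrangement K ℓ} {c d : Fin ℓ → K} (hc : c ∈ A.hyps)
    (hd : d ∈ A.hyps) (hcd : c ≠ d) : ¬ linP c ∣ linP d := fun h => by
  obtain ⟨t, ht⟩ := exists_eq_smul_of_linP_dvd (A.ne_zero c hc) h
  exact A.nonprop d hd c hc hcd.symm t ht

theorem isRelPrime_linP {A : Arrangement K ℓ} {c d : Fin ℓ → K} (hc : c ∈ A.hyps)
    (hd : d ∈ A.hyps) (hcd : c ≠ d) : IsRelPrime (linP c) (linP d) :=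
  (prime_linP (A.ne_zero c hc)).irreducible.isRelPrime_iff_not_dvd.mpr
    (linP_not_dvd_linP hc hd hcd)

theorem algebraMap_mem_Omega_zero {A : Arrangement K ℓ} {f : PS K ℓ} :
    algebraMap (PS K ℓ) (ExtF K ℓ) f ∈ Omega A (fun _ => 1) 0 ↔ ∀ c ∈ A.hyps, linP c ∣ f := by
  have h1 : algebraMap (PS K ℓ) (ExtF K ℓ) f ∈ formsP K ℓ 0 := by
    rw [formsP, pow_zero]
    exact Submodule.algebraMap_mem f
  simp only [Omega, Submodule.mem_inf, h1, true_and, Submodule.mem_iInf, Submodule.mem_comap,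
    Submodule.mem_map, pow_one, LinearMap.mulLeft_apply, LinearMap.lsmul_apply]
  refine forall₂_congr fun c hc => ?_
  rw [← Algebra.commutes, ← Algebra.smul_def]
  constructor
  · rintro ⟨ξ, hξ, h⟩
    rw [zero_add, formsP, pow_one] at hξ
    obtain ⟨w, rfl⟩ := hξ
    rw [dP, ← map_smul, ← map_smul] at h
    have h2 := ExteriorAlgebra.ι_leftInverse.injective h
    obtain ⟨j, hj⟩ := Function.ne_iff.mp (A.ne_zero c hc)
    simp only [Pi.zero_apply] at hj
    have h3 := congrFun h2 j
    simp only [Pi.smul_apply, smul_eq_mul] at h3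
    have h4 : (C (c j) * C (c j)⁻¹ : PS K ℓ) = 1 := by
      rw [← C_mul, mul_inv_cancel₀ hj, C_1]
    exact ⟨w j * C (c j)⁻¹, by linear_combination -f * h4 - C (c j)⁻¹ * h3⟩
  · rintro ⟨g, rfl⟩
    refine ⟨g • dP c, Submodule.smul_mem _ _ ?_, smul_smul _ _ _⟩
    rw [zero_add, formsP, pow_one]
    exact ⟨_, rfl⟩

/-- `Ω^0(A)` is free of rank one. -/
theorem projective_Omega_zero (A : Arrangement K ℓ) :
    Module.Projective (PS K ℓ) (Omega A (fun _ => 1) 0) := by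
  let f : PS K ℓ := ∏ c ∈ A.hyps, linP c
  have hf0 : f ≠ 0 := Finset.prod_ne_zero_iff.mpr fun c hc => linP_ne_zero (A.ne_zero c hc)
  let g : PS K ℓ →ₗ[PS K ℓ] Omega A (fun _ => 1) 0 :=
    LinearMap.codRestrict _ ((Algebra.linearMap (PS K ℓ) (ExtF K ℓ)).comp
      (LinearMap.mulLeft (PS K ℓ) f)) fun s => algebraMap_mem_Omega_zero.mpr
        fun c hc => (Finset.dvd_prod_of_mem _ hc).mul_right s
  have hg : Function.Bijective g := by
    constructor
    · intro s t h
      exact mul_left_cancel₀ hf0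
        (ExteriorAlgebra.algebraMap_leftInverse _ |>.injective (congrArg Subtype.val h))
    · rintro ⟨η, hη⟩
      have h1 : η ∈ formsP K ℓ 0 := hη.1
      rw [formsP, pow_zero] at h1
      obtain ⟨r, rfl⟩ := Submodule.mem_one.mp h1
      obtain ⟨s, rfl⟩ := Finset.prod_dvd_of_isRelPrime
        (fun c hc d hd h => isRelPrime_linP hc hd h) (algebraMap_mem_Omega_zero.mp hη)
      exact ⟨s, rfl⟩
  exact Module.Projective.of_equiv (LinearEquiv.ofBijective g hg)

/-- Exactness of the Koszul complex of `α, a, b` on `M` in degree one, up to multiplication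
by `q`. -/
def KoszulExactUpTo {R : Type} [CommRing R] (α a b q : R) (M : Type) [AddCommGroup M]
    [Module R M] : Prop :=
  ∀ u v y : M, b • u - a • v = α • y →
    ∃ w z t : M, q • u = a • w + α • z ∧ q • v = b • w + α • t ∧ q • y = b • z - a • t

namespace KoszulExactUpTo

variable {R : Type} [CommRing R] {α a b q : R} {M N : Type} [AddCommGroup M] [Module R M]
  [AddCommGroup N] [Module R N]

theorem of_regular [IsDomain R] (hα : α ≠ 0) (ha : ∀ s, α ∣ a * s → α ∣ s)
    (hb : ∀ s, b * s ∈ Ideal.span {α, a} → s ∈ Ideal.span {α, a}) :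
    KoszulExactUpTo α a b 1 R := by
  intro u v y h
  simp only [smul_eq_mul] at h
  obtain ⟨z, w, hu⟩ := Ideal.mem_span_pair.mp
    (hb u (Ideal.mem_span_pair.mpr ⟨y, v, by linear_combination -h⟩))
  obtain ⟨t, ht⟩ := ha (v - b * w) ⟨b * z - y, by linear_combination -b * hu - h⟩
  refine ⟨w, z, t, ?_, ?_, ?_⟩ <;> simp only [smul_eq_mul]
  · linear_combination -hu
  · linear_combination ht
  · apply mul_left_cancel₀ hα
    linear_combination -h - b * hu - a * ht

theorem pi (h : KoszulExactUpTo α a b q R) (ι : Type) : KoszulExactUpTo α a b q (ι → R) := by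
  intro u v y huv
  choose w z t h1 h2 h3 using fun i => h (u i) (v i) (y i) (congrFun huv i)
  exact ⟨w, z, t, funext h1, funext h2, funext h3⟩

theorem of_linearEquiv (e : M ≃ₗ[R] N) (h : KoszulExactUpTo α a b q M) :
    KoszulExactUpTo α a b q N := by
  intro u v y huv
  obtain ⟨w, z, t, h1, h2, h3⟩ := h (e.symm u) (e.symm v) (e.symm y) (by
    rw [← map_smul, ← map_smul, ← map_smul, ← map_sub, huv])
  refine ⟨e w, e z, e t, ?_, ?_, ?_⟩ <;> apply e.symm.injective <;> simpa

theorem of_free [Module.Free R M] [Module.Finite R M] (h : KoszulExactUpTo α a b q R) :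
    KoszulExactUpTo α a b q M :=
  (h.pi _).of_linearEquiv (Module.Free.chooseBasis R M).equivFun.symm

theorem of_le {M F : Submodule R N} (hMF : M ≤ F) (hq : ∀ x ∈ F, q • x ∈ M)
    (h : KoszulExactUpTo α a b 1 F) : KoszulExactUpTo α a b q M := by
  intro u v y huv
  obtain ⟨w, z, t, h1, h2, h3⟩ := h ⟨u, hMF u.2⟩ ⟨v, hMF v.2⟩ ⟨y, hMF y.2⟩
    (Subtype.ext (by simpa using congrArg Subtype.val huv))
  have h1' := congrArg (fun x : F => q • (x : N)) h1
  have h2' := congrArg (fun x : F => q • (x : N)) h2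
  have h3' := congrArg (fun x : F => q • (x : N)) h3
  refine ⟨⟨_, hq w w.2⟩, ⟨_, hq z z.2⟩, ⟨_, hq t t.2⟩, ?_, ?_, ?_⟩ <;> apply Subtype.ext
  · simpa [smul_comm q] using h1'
  · simpa [smul_comm q] using h2'
  · simpa [smul_comm q, smul_sub] using h3'

end KoszulExactUpTo

theorem exists_of_mem_span_triple_smul {R M : Type} [CommRing R] [AddCommGroup M] [Module R M]
    {α a b : R} {x : M} (hx : x ∈ Ideal.span {α, a, b} • (⊤ : Submodule R M)) :
    ∃ x1 x2 x3 : M, x = α • x1 + a • x2 + b • x3 := by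
  refine Submodule.smul_induction_on hx (fun r hr n _ => ?_) fun x y hx hy => ?_
  · obtain ⟨r1, s, hs, rfl⟩ := Ideal.mem_span_insert.mp hr
    obtain ⟨r2, r3, rfl⟩ := Ideal.mem_span_pair.mp hs
    exact ⟨r1 • n, r2 • n, r3 • n, by module⟩
  · obtain ⟨x1, x2, x3, rfl⟩ := hx
    obtain ⟨y1, y2, y3, rfl⟩ := hy
    exact ⟨x1 + y1, x2 + y2, x3 + y3, by module⟩

/-- An element that is regular modulo `J` is regular on `P / J P` for `P` projective. -/
theorem mem_smul_top_of_smul_mem {R P : Type} [CommRing R] [AddCommGroup P] [Module R P]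
    [Module.Projective R P] {J : Ideal R} {c : R} (hc : ∀ s, c * s ∈ J → s ∈ J) {e : P}
    (he : c • e ∈ J • (⊤ : Submodule R P)) : e ∈ J • (⊤ : Submodule R P) := by
  obtain ⟨s, hs⟩ := Module.projective_def.mp (inferInstance : Module.Projective R P)
  rw [← hs e, Finsupp.linearCombination_apply]
  refine Submodule.sum_mem _ fun i _ => Submodule.smul_mem_smul (hc _ ?_) trivial
  have h : ∀ x ∈ J • (⊤ : Submodule R P), s x i ∈ J := by
    intro x hx
    refine Submodule.smul_induction_on hx (fun r hr n _ => ?_) fun x y hx hy => ?_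
    · simpa using J.mul_mem_right _ hr
    · simpa using J.add_mem hx hy
  simpa using h _ he

theorem mem_smul_top_of_pow_smul_mem {R P : Type} [CommRing R] [AddCommGroup P] [Module R P]
    [Module.Projective R P] {J : Ideal R} {c : R} (hc : ∀ s, c * s ∈ J → s ∈ J) {e : P} {k : ℕ}
    (he : c ^ k • e ∈ J • (⊤ : Submodule R P)) : e ∈ J • (⊤ : Submodule R P) := by
  induction k with
  | zero => simpa using he
  | succ k ih =>
    rw [pow_succ', mul_smul] at he
    exact ih (mem_smul_top_of_smul_mem hc he)

/-- Over a Noetherian ring, a finite module of projective dimension at most one whose Koszul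
homology is killed by a power of an element regular modulo the sequence has no Koszul homology. -/
theorem KoszulExactUpTo.one_of_pdLE_one {R : Type} [CommRing R] [IsNoetherianRing R]
    {α a b c : R} (h : KoszulExactUpTo α a b 1 R)
    (hc : ∀ s, c * s ∈ Ideal.span {α, a, b} → s ∈ Ideal.span {α, a, b})
    {M : Type} [AddCommGroup M] [Module R M] [Module.Finite R M] (hM : pdLE R 1 M)
    (hrad : ∀ E : Ideal R, α ∈ E → (∀ q, KoszulExactUpTo α a b q M → q ∈ E) → c ∈ E.radical) :
    KoszulExactUpTo α a b 1 M := by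
  obtain ⟨n, f, hf⟩ := Module.Finite.exists_fin' R M
  have : Module.Projective R (LinearMap.ker f) := pdLE_ker_of_surjective hf hM
  intro u v y huv
  obtain ⟨U, rfl⟩ := hf u
  obtain ⟨V, rfl⟩ := hf v
  obtain ⟨Y, rfl⟩ := hf y
  have he : b • U - a • V - α • Y ∈ LinearMap.ker f := by
    simp [huv]
  let N : Submodule R (LinearMap.ker f) := Ideal.span {α, a, b} • ⊤
  have hα : ∀ x : LinearMap.ker f, α • x ∈ N := fun x =>
    Submodule.smul_mem_smul (Ideal.subset_span (by simp)) trivial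
  have ha : ∀ x : LinearMap.ker f, a • x ∈ N := fun x =>
    Submodule.smul_mem_smul (Ideal.subset_span (by simp)) trivial
  have hb : ∀ x : LinearMap.ker f, b • x ∈ N := fun x =>
    Submodule.smul_mem_smul (Ideal.subset_span (by simp)) trivial
  obtain ⟨k, hk⟩ := hrad (Submodule.comap (LinearMap.toSpanSingleton R _ ⟨_, he⟩) N)
    (hα _) fun q hq => by
      obtain ⟨w, z, t, h1, h2, h3⟩ := hq _ _ _ huv
      obtain ⟨W, rfl⟩ := hf w
      obtain ⟨Z, rfl⟩ := hf z
      obtain ⟨T, rfl⟩ := hf t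
      let k1 : LinearMap.ker f := ⟨q • U - a • W - α • Z, by simp [h1]⟩
      let k2 : LinearMap.ker f := ⟨q • V - b • W - α • T, by simp [h2]⟩
      let k3 : LinearMap.ker f := ⟨q • Y - b • Z + a • T, by simp [h3]⟩
      have : b • k1 - a • k2 - α • k3 ∈ N := N.sub_mem (N.sub_mem (hb _) (ha _)) (hα _)
      refine (congrArg (· ∈ N) ?_).mpr this
      apply Subtype.ext
      simp only [LinearMap.toSpanSingleton_apply, k1, k2, k3, Submodule.coe_smul,
        Submodule.coe_sub]
      module
  obtain ⟨⟨e1, h1⟩, ⟨e2, h2⟩, ⟨e3, h3⟩, h123⟩ :=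
    exists_of_mem_span_triple_smul (mem_smul_top_of_pow_smul_mem hc hk)
  have h123 : b • U - a • V - α • Y = α • e1 + a • e2 + b • e3 := congrArg Subtype.val h123
  obtain ⟨W, Z, T, hW, hZ, hT⟩ := h.pi (Fin n) (U - e3) (V + e2) (Y + e1) (by
    rw [← sub_eq_zero] at h123 ⊢
    rw [← h123]
    module)
  rw [LinearMap.mem_ker] at h1 h2 h3
  refine ⟨f W, f Z, f T, ?_, ?_, ?_⟩
  · simpa [h3] using congrArg f hW
  · simpa [h2] using congrArg f hZ
  · simpa [h1] using congrArg f hT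

theorem Ideal.eq_bot_of_eq_span_singleton_mul {T : Type} [CommRing T] [IsDomain T]
    [UniqueFactorizationMonoid T] {J : Ideal T} {a : T} (ha : Prime a)
    (h : J = Ideal.span {a} * J) : J = ⊥ := by
  have hn : ∀ n : ℕ, ∀ x ∈ J, a ^ n ∣ x := by
    intro n
    induction n with
    | zero => simp
    | succ n ih =>
      intro x hx
      rw [h, Ideal.mem_span_singleton_mul] at hx
      obtain ⟨y, hy, rfl⟩ := hx
      rw [pow_succ']
      exact mul_dvd_mul_left a (ih y hy)
  rw [eq_bot_iff]
  intro x hx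
  by_contra hx0
  obtain ⟨n, hn'⟩ := FiniteMultiplicity.of_prime_left ha hx0
  exact hn' (hn _ x hx)

/-- A nonprincipal ideal in a Noetherian factorial domain has an associated prime of height at
least two. -/
theorem exists_associated_prime_of_not_isPrincipal {T : Type} [CommRing T] [IsDomain T]
    [UniqueFactorizationMonoid T] [IsNoetherianRing T] {I : Ideal T}
    (hI : ¬ Submodule.IsPrincipal I) :
    ∃ (P : Ideal T) (g : T), P.IsPrime ∧ (∀ s, s ∈ P ↔ s * g ∈ I) ∧
      ∃ a ∈ P, Prime a ∧ ∃ b ∈ P, ¬ a ∣ b := by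
  obtain ⟨J, ⟨d, hd, hIJ⟩, hmax⟩ := WellFounded.has_min (r := fun I J : Ideal T => J < I)
    wellFounded_gt {J : Ideal T | ∃ d ≠ 0, I = Ideal.span {d} * J}
    ⟨I, 1, one_ne_zero, by simp⟩
  have hJtop : J ≠ ⊤ := by
    rintro rfl
    exact hI ⟨d, by rw [hIJ, Ideal.mul_top]⟩
  have hJbot : J ≠ ⊥ := by
    rintro rfl
    exact hI ⟨0, by simp [hIJ]⟩
  have : Nontrivial (T ⧸ J) := Ideal.Quotient.nontrivial_iff.mpr hJtop
  obtain ⟨P, hP⟩ := associatedPrimes.nonempty T (T ⧸ J)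
  obtain ⟨hPp, x, hx⟩ := isAssociatedPrime_iff.mp hP
  obtain ⟨g, rfl⟩ := Ideal.Quotient.mk_surjective x
  have hPg : ∀ s, s ∈ P ↔ s * g ∈ J := by
    intro s
    rw [hx, Submodule.mem_colon_singleton, Submodule.mem_bot, Algebra.smul_def,
      Ideal.Quotient.algebraMap_eq, ← map_mul, Ideal.Quotient.eq_zero_iff_mem]
  have hJP : J ≤ P := fun s hs => (hPg s).mpr (J.mul_mem_right g hs)
  obtain ⟨a, haP, ha⟩ := Ideal.IsPrime.exists_mem_prime_of_ne_bot hPp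
    (ne_bot_of_le_ne_bot hJbot hJP)
  refine ⟨P, d * g, hPp, fun s => ?_, a, haP, ha, ?_⟩
  · rw [hPg, hIJ, Ideal.mem_span_singleton_mul]
    constructor
    · exact fun h => ⟨_, h, by ring⟩
    · rintro ⟨z, hz, h⟩
      rwa [← mul_left_cancel₀ hd (show d * z = d * (s * g) by rw [h]; ring)]
  · by_contra! hab
    obtain ⟨J', hJ'⟩ : ∃ J', J = Ideal.span {a} * J' := by
      refine ⟨Submodule.comap (LinearMap.mulLeft T a) J, ?_⟩
      ext s
      rw [Ideal.mem_span_singleton_mul]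
      constructor
      · intro hs
        obtain ⟨y, rfl⟩ := hab s (hJP hs)
        exact ⟨y, hs, rfl⟩
      · rintro ⟨y, hy, rfl⟩
        exact hy
    have hJJ' : J ≤ J' := hJ'.trans_le Ideal.mul_le_right
    have := hmax J' ⟨d * a, mul_ne_zero hd ha.ne_zero, by
      rw [hIJ, hJ', ← mul_assoc, Ideal.span_singleton_mul_span_singleton]⟩
    have hJ2 : J = J' := by
      by_contra hne
      exact this (lt_of_le_of_ne hJJ' hne)
    exact hJbot (Ideal.eq_bot_of_eq_span_singleton_mul ha (hJ'.trans (by rw [hJ2])))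

section

variable {A : Arrangement K ℓ} {c0 : Fin ℓ → K}

theorem logOneForms_le_of_subset {B : Arrangement K ℓ} (h : B.hyps ⊆ A.hyps) :
    logOneForms A ≤ logOneForms B :=
  fun _ hv c hc => hv c (h hc)

theorem logOneForms_le_delArr : logOneForms A ≤ logOneForms (delArr A c0) :=
  logOneForms_le_of_subset (Finset.erase_subset _ _)

theorem mem_logOneForms_of_delArr {v : Fin ℓ → PS K ℓ} (hv : v ∈ logOneForms (delArr A c0))
    (h0 : ∀ i k, linP c0 ∣ C (c0 i) * v k - C (c0 k) * v i) : v ∈ logOneForms A := by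
  intro c hc
  by_cases h : c = c0
  · exact h ▸ h0
  · exact hv c (Finset.mem_erase.mpr ⟨h, hc⟩)

theorem linP_smul_mem_logOneForms {v : Fin ℓ → PS K ℓ} (hv : v ∈ logOneForms (delArr A c0)) :
    linP c0 • v ∈ logOneForms A :=
  mem_logOneForms_of_delArr (Submodule.smul_mem _ _ hv) fun i k =>
    ⟨C (c0 i) * v k - C (c0 k) * v i, by simp only [Pi.smul_apply, smul_eq_mul]; ring⟩

theorem mem_logOneForms_of_smul_mem (hc0 : c0 ∈ A.hyps) {v : Fin ℓ → PS K ℓ}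
    (hv : v ∈ logOneForms (delArr A c0)) {a : PS K ℓ} (ha : ¬ linP c0 ∣ a)
    (hav : a • v ∈ logOneForms A) : v ∈ logOneForms A :=
  mem_logOneForms_of_delArr hv fun i k => by
    refine ((prime_linP (A.ne_zero c0 hc0)).dvd_or_dvd (a := a) ?_).resolve_left ha
    convert hav c0 hc0 i k using 1
    simp only [Pi.smul_apply, smul_eq_mul]
    ring

theorem exists_eq_linP_smul (hc0 : c0 ∈ A.hyps) {j : Fin ℓ} (hj : c0 j ≠ 0)
    {v : Fin ℓ → PS K ℓ} (hv : v ∈ logOneForms A) (hvj : linP c0 ∣ v j) :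
    ∃ w ∈ logOneForms (delArr A c0), v = linP c0 • w := by
  have h : ∀ k, linP c0 ∣ v k := by
    intro k
    have h1 : linP c0 ∣ C (c0 j) * v k := by
      simpa using (hv c0 hc0 j k).add (hvj.mul_left (C (c0 k)))
    have h2 : (C (c0 j)⁻¹ * C (c0 j) : PS K ℓ) = 1 := by
      rw [← C_mul, inv_mul_cancel₀ hj, C_1]
    have h3 := h1.mul_left (C (c0 j)⁻¹)
    rwa [← mul_assoc, h2, one_mul] at h3
  choose w hw using h
  obtain rfl : v = linP c0 • w := funext hw
  refine ⟨w, fun c hc i k => ?_, rfl⟩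
  obtain ⟨hne, hc⟩ := Finset.mem_erase.mp hc
  refine ((prime_linP (A.ne_zero c hc)).dvd_or_dvd (a := linP c0) ?_).resolve_left
    (linP_not_dvd_linP hc hc0 hne)
  convert hv c hc i k using 1
  simp only [Pi.smul_apply, smul_eq_mul]
  ring

/-- The product of the defining forms of the hyperplanes not containing the point `x`. -/
def awayProd (A : Arrangement K ℓ) (x : Fin ℓ → K) : PS K ℓ :=
  ∏ c ∈ A.hyps with ∑ i, c i * x i ≠ 0, linP c

theorem awayProd_smul_mem {x : Fin ℓ → K} {v : Fin ℓ → PS K ℓ}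
    (hv : v ∈ logOneForms (locArr A x)) : awayProd A x • v ∈ logOneForms A := by
  intro c hc i k
  by_cases h : ∑ i, c i * x i = 0
  · exact Submodule.smul_mem _ (awayProd A x) hv c (Finset.mem_filter.mpr ⟨hc, h⟩) i k
  · have h1 : linP c ∣ awayProd A x := Finset.dvd_prod_of_mem _ (Finset.mem_filter.mpr ⟨hc, h⟩)
    convert h1.mul_right (C (c i) * v k - C (c k) * v i) using 1
    simp only [Pi.smul_apply, smul_eq_mul]
    ring

theorem awayProd_notMem {P : Ideal (PS K ℓ)} [P.IsPrime] {x : Fin ℓ → K}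
    (hx : ∀ c : Fin ℓ → K, linP c ∈ P → ∑ i, c i * x i = 0) : awayProd A x ∉ P := by
  intro h
  obtain ⟨c, hc, hcP⟩ := (Ideal.IsPrime.prod_mem_iff).mp h
  exact (Finset.mem_filter.mp hc).2 (hx c hcP)

theorem KoszulExactUpTo.awayProd {α a b : PS K ℓ} (h : KoszulExactUpTo α a b 1 (PS K ℓ))
    {x : Fin ℓ → K} (hfree : FreeM (locArr A x) (fun _ => 1)) :
    KoszulExactUpTo α a b (awayProd A x) (logOneForms A) := by
  have : Module.Free (PS K ℓ) (logOneForms (locArr A x)) :=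
    have : Module.Free (PS K ℓ) (Omega (locArr A x) (fun _ => 1) 1) := hfree
    Module.Free.of_equiv (logOneFormsEquiv (locArr A x)).symm
  exact KoszulExactUpTo.of_le (logOneForms_le_of_subset (Finset.filter_subset _ _))
    (fun v hv => awayProd_smul_mem hv) h.of_free

end

/-- Either all linear forms lie in the ideal `P`, or those that do have a common nonzero zero. -/
theorem forall_linP_mem_or_exists (P : Ideal (PS K ℓ)) :
    (∀ c : Fin ℓ → K, linP c ∈ P) ∨
      ∃ x : Fin ℓ → K, x ≠ 0 ∧ ∀ c : Fin ℓ → K, linP c ∈ P → ∑ i, c i * x i = 0 := by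
  let W : Submodule K (Fin ℓ → K) :=
    { carrier := {c | linP c ∈ P}
      zero_mem' := by simp [linP]
      add_mem' := by
        intro c d hc hd
        convert P.add_mem hc hd using 1
        simp [linP, add_mul, Finset.sum_add_distrib]
      smul_mem' := by
        intro t c hc
        convert P.mul_mem_left (C t) hc using 1
        simp [linP, Finset.mul_sum, mul_assoc] }
  by_cases hW : W = ⊤
  · exact Or.inl fun c => (hW ▸ Submodule.mem_top : c ∈ W)
  · obtain ⟨f, hf, hWf⟩ := W.exists_le_ker_of_lt_top (lt_top_iff_ne_top.mpr hW)
    have hsum : ∀ c, f c = ∑ i, c i * f (Pi.single i 1) := by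
      intro c
      conv_lhs => rw [pi_eq_sum_univ' c]
      simp
    refine Or.inr ⟨fun i => f (Pi.single i 1), fun h0 => hf ?_, fun c hc => ?_⟩
    · ext i
      simpa using congrFun h0 i
    · rw [← hsum]
      exact hWf hc

theorem mem_radical_of_awayProd_mem {A : Arrangement K ℓ} {c0 : Fin ℓ → K} {E : Ideal (PS K ℓ)}
    (h0 : linP c0 ∈ E)
    (hE : ∀ x : Fin ℓ → K, x ≠ 0 → ∑ i, c0 i * x i = 0 → awayProd A x ∈ E) (d : Fin ℓ → K) :
    linP d ∈ E.radical := by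
  rw [Ideal.radical_eq_sInf, Submodule.mem_sInf]
  rintro P ⟨hEP, hP⟩
  obtain h | ⟨x, hx, h⟩ := forall_linP_mem_or_exists P
  · exact h d
  · exact absurd (hEP (hE x hx (h c0 (hEP h0)))) (awayProd_notMem h)

theorem mem_of_X_mul_mem_span_X_image {σ : Type} {s : Set σ} {i : σ} (hi : i ∉ s)
    {p : MvPolynomial σ K} (h : X i * p ∈ Ideal.span (X '' s : Set (MvPolynomial σ K))) :
    p ∈ Ideal.span (X '' s : Set (MvPolynomial σ K)) := by
  rw [mem_ideal_span_X_image] at h ⊢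
  intro m hm
  obtain ⟨k, hk, hmk⟩ := h (Finsupp.single i 1 + m) (by
    rw [support_X_mul]
    exact Finset.mem_map_of_mem _ hm)
  have hne : i ≠ k := fun h => hi (h ▸ hk)
  exact ⟨k, hk, by simpa [hne] using hmk⟩

section

variable {n : ℕ} {c : Fin (n + 1) → K} {j : Fin (n + 1)}

theorem mem_span_insert_linP_iff (hj : c j ≠ 0) {s : PS K (n + 1)} {t : Set (PS K (n + 1))} :
    s ∈ Ideal.span (insert (linP c) t) ↔
      restrictHyp c j s ∈ Ideal.span (restrictHyp c j '' t) := by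
  have hπ := restrictHyp_surjective c j
  have h0 : restrictHyp c j (linP c) = 0 := (restrictHyp_eq_zero_iff hj).mpr dvd_rfl
  constructor
  · intro h
    have := Ideal.mem_map_of_mem (restrictHyp c j) h
    rw [Ideal.map_span, Set.image_insert_eq, h0, Ideal.span_insert_zero] at this
    exact this
  · intro h
    have h' : restrictHyp c j s ∈ Ideal.map (restrictHyp c j) (Ideal.span t) := by
      rwa [Ideal.map_span]
    obtain ⟨r, hr, hrs⟩ := (Ideal.mem_map_iff_of_surjective _ hπ).mp h'
    rw [← sub_eq_zero, ← map_sub, restrictHyp_eq_zero_iff hj] at hrs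
    obtain ⟨z, hz⟩ := hrs
    exact Ideal.mem_span_insert.mpr ⟨-z, r, hr, by linear_combination -hz⟩

theorem KoszulExactUpTo.of_restrictHyp (hc : c ≠ 0) (hj : c j ≠ 0) {a b : PS K (n + 1)}
    (ha : Prime (restrictHyp c j a)) (hab : ¬ restrictHyp c j a ∣ restrictHyp c j b) :
    KoszulExactUpTo (linP c) a b 1 (PS K (n + 1)) := by
  refine KoszulExactUpTo.of_regular (linP_ne_zero hc) (fun s hs => ?_) fun s hs => ?_
  · refine ((prime_linP hc).dvd_or_dvd hs).resolve_left fun h => ha.ne_zero ?_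
    exact (restrictHyp_eq_zero_iff hj).mpr h
  · rw [mem_span_insert_linP_iff hj, Set.image_singleton, Ideal.mem_span_singleton] at hs ⊢
    rw [map_mul] at hs
    exact (ha.dvd_or_dvd hs).resolve_left hab

/-- The ideal of restrictions to the hyperplane of the `j`-th coefficients of logarithmic
one-forms (their residues, up to a scalar). -/
def residueIdeal (A : Arrangement K (n + 1)) (c : Fin (n + 1) → K) (j : Fin (n + 1)) :
    Ideal (PS K n) :=
  Ideal.map (restrictHyp c j) (Submodule.map (LinearMap.proj j) (logOneForms A))

variable {A : Arrangement K (n + 1)}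

theorem mem_residueIdeal {g : PS K n} :
    g ∈ residueIdeal A c j ↔ ∃ v ∈ logOneForms A, restrictHyp c j (v j) = g := by
  rw [residueIdeal, Ideal.mem_map_iff_of_surjective _ (restrictHyp_surjective c j)]
  simp [Submodule.mem_map]

/-- Koszul exactness for the logarithmic forms of the deletion transfers membership in the
residue ideal. -/
theorem KoszulExactUpTo.mul_mem_residueIdeal (hcA : c ∈ A.hyps) (hj : c j ≠ 0)
    {a b q : PS K (n + 1)} (ha : restrictHyp c j a ≠ 0)
    (h : KoszulExactUpTo (linP c) a b q (logOneForms (delArr A c))) {g : PS K n}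
    (hag : restrictHyp c j a * g ∈ residueIdeal A c j)
    (hbg : restrictHyp c j b * g ∈ residueIdeal A c j) :
    restrictHyp c j q * g ∈ residueIdeal A c j := by
  obtain ⟨u, hu, hug⟩ := mem_residueIdeal.mp hag
  obtain ⟨v, hv, hvg⟩ := mem_residueIdeal.mp hbg
  obtain ⟨y, hy, huvy⟩ := exists_eq_linP_smul hcA hj
    (Submodule.sub_mem _ (Submodule.smul_mem _ b hu) (Submodule.smul_mem _ a hv)) (by
      rw [← restrictHyp_eq_zero_iff hj]
      simp only [Pi.sub_apply, Pi.smul_apply, smul_eq_mul, map_sub, map_mul, hug, hvg]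
      ring)
  obtain ⟨⟨w, hw⟩, ⟨z, hz⟩, -, h1, -, -⟩ := h ⟨u, logOneForms_le_delArr hu⟩
    ⟨v, logOneForms_le_delArr hv⟩ ⟨y, hy⟩ (Subtype.ext huvy)
  have h1 : q • u = a • w + linP c • z := congrArg Subtype.val h1
  have hwA : w ∈ logOneForms A := by
    refine mem_logOneForms_of_smul_mem hcA hw (a := a)
      (fun h => ha ((restrictHyp_eq_zero_iff hj).mpr h)) ?_
    rw [← sub_eq_iff_eq_add.mpr h1]
    exact Submodule.sub_mem _ (Submodule.smul_mem _ q hu) (linP_smul_mem_logOneForms hz)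
  refine mem_residueIdeal.mpr ⟨w, hwA, mul_left_cancel₀ ha ?_⟩
  have h2 := congrArg (restrictHyp c j) (congrFun h1 j)
  have h0 : restrictHyp c j (linP c) = 0 := (restrictHyp_eq_zero_iff hj).mpr dvd_rfl
  simp only [Pi.add_apply, Pi.smul_apply, smul_eq_mul, map_add, map_mul, hug, h0] at h2
  linear_combination -h2

/-- A principal residue ideal bounds the projective dimension of the logarithmic one-forms. -/
theorem pdLE_one_logOneForms (hcA : c ∈ A.hyps) (hj : c j ≠ 0)
    (hpd : pdLE (PS K (n + 1)) 1 (logOneForms (delArr A c)))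
    (hI : Submodule.IsPrincipal (residueIdeal A c j)) :
    pdLE (PS K (n + 1)) 1 (logOneForms A) := by
  obtain ⟨d, hd⟩ := hI
  have hdI : d ∈ residueIdeal A c j := hd ▸ Submodule.mem_span_singleton_self d
  obtain ⟨v0, hv0, hv0d⟩ := mem_residueIdeal.mp hdI
  have hα : linP c ≠ 0 := linP_ne_zero (A.ne_zero c hcA)
  have h0 : restrictHyp c j (linP c) = 0 := (restrictHyp_eq_zero_iff hj).mpr dvd_rfl
  let μ : logOneForms (delArr A c) →ₗ[PS K (n + 1)] logOneForms A :=
    LinearMap.codRestrict _ (linP c • (logOneForms (delArr A c)).subtype)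
      fun v => linP_smul_mem_logOneForms v.2
  have hμ : Function.Injective μ := fun u v h =>
    Subtype.ext (smul_right_injective _ hα (congrArg Subtype.val h))
  have hμs : ∀ v : logOneForms A, restrictHyp c j (v.1 j) = 0 → ∃ w, μ w = v := by
    rintro ⟨v, hv⟩ h
    obtain ⟨w, hw, hvw⟩ := exists_eq_linP_smul hcA hj hv ((restrictHyp_eq_zero_iff hj).mp h)
    exact ⟨⟨w, hw⟩, Subtype.ext hvw.symm⟩
  by_cases hd0 : d = 0
  · refine pdLE_of_linearEquiv (LinearEquiv.ofBijective μ ⟨hμ, fun v => hμs v ?_⟩) hpd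
    have : restrictHyp c j (v.1 j) ∈ residueIdeal A c j := mem_residueIdeal.mpr ⟨v, v.2, rfl⟩
    rw [hd, hd0] at this
    simpa using this
  · let g : (logOneForms (delArr A c) × PS K (n + 1)) →ₗ[PS K (n + 1)] logOneForms A :=
      μ.coprod (LinearMap.toSpanSingleton _ _ ⟨v0, hv0⟩)
    have hg : Function.Surjective g := by
      intro v
      have hv : restrictHyp c j (v.1 j) ∈ residueIdeal A c j := mem_residueIdeal.mpr ⟨v, v.2, rfl⟩
      rw [hd] at hv
      obtain ⟨t, ht⟩ := Submodule.mem_span_singleton.mp hv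
      obtain ⟨s, rfl⟩ := restrictHyp_surjective c j t
      obtain ⟨w, hw⟩ := hμs (v - s • ⟨v0, hv0⟩) (by
        simp only [Submodule.coe_sub, Submodule.coe_smul, Pi.sub_apply, Pi.smul_apply, map_sub,
          smul_eq_mul, map_mul, hv0d]
        rw [← ht, smul_eq_mul, sub_self])
      exact ⟨(w, s), by simp [g, hw]⟩
    let f : PS K (n + 1) →ₗ[PS K (n + 1)] (logOneForms (delArr A c) × PS K (n + 1)) :=
      (LinearMap.toSpanSingleton _ _ ⟨-v0, Submodule.neg_mem _ (logOneForms_le_delArr hv0)⟩).prod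
        (LinearMap.lsmul _ _ (linP c))
    have hf : Function.Injective f := fun s t h =>
      mul_left_cancel₀ hα (congrArg Prod.snd h)
    have hfg : Function.Exact f g := by
      rintro ⟨w, s⟩
      constructor
      · intro h
        have h1 : linP c • (w : Fin (n + 1) → PS K (n + 1)) + s • v0 = 0 := congrArg Subtype.val h
        have h2 := congrArg (restrictHyp c j) (congrFun h1 j)
        simp only [Pi.add_apply, Pi.smul_apply, smul_eq_mul, map_add, map_mul, h0, hv0d, zero_mul,
          zero_add, Pi.zero_apply, map_zero, mul_eq_zero, hd0, or_false] at h2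
        obtain ⟨t, rfl⟩ := (restrictHyp_eq_zero_iff hj).mp h2
        refine ⟨t, Prod.ext (Subtype.ext ?_) rfl⟩
        apply smul_right_injective _ hα
        change linP c • (t • -v0) = linP c • (w : Fin (n + 1) → PS K (n + 1))
        rw [← sub_eq_zero, ← neg_eq_zero, ← h1]
        module
      · rintro ⟨t, ht⟩
        rw [← ht]
        apply Subtype.ext
        change linP c • (t • -v0) + (linP c • t) • v0 = 0
        rw [smul_eq_mul]
        module
    refine pdLE_of_exact_right hf hfg hg (pdLE_of_projective (n := 0)) ?_
    exact pdLE_of_exact_middle (f := LinearMap.inl _ _ _) (g := LinearMap.snd _ _ _)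
      LinearMap.inl_injective .inl_snd LinearMap.snd_surjective hpd pdLE_of_projective

end

/-- In dimension four the Koszul complex of `α` and two further coordinates is exact on the
logarithmic one-forms of a tame deletion that is locally free along the hyperplane. -/
theorem koszulExactUpTo_one_logOneForms {A : Arrangement K 4} {c : Fin 4 → K} {j : Fin 4}
    (hc : c ≠ 0) (hj : c j ≠ 0) (hpd : pdLE (PS K 4) 1 (logOneForms A))
    (hfree : LocallyFreeAlong A (fun _ => 1) c) :
    KoszulExactUpTo (linP c) (X (j.succAbove 0)) (X (j.succAbove 1)) 1 (logOneForms A) := by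
  have h01 : ¬ (X 0 : PS K 3) ∣ X 1 := by
    rw [X_dvd_X]
    decide
  have h : KoszulExactUpTo (linP c) (X (j.succAbove 0)) (X (j.succAbove 1)) 1 (PS K 4) := by
    apply KoszulExactUpTo.of_restrictHyp hc hj
    · rw [restrictHyp_X_succAbove]
      exact X_prime
    · rwa [restrictHyp_X_succAbove, restrictHyp_X_succAbove]
  refine KoszulExactUpTo.one_of_pdLE_one (c := X (j.succAbove 2)) h (fun s hs => ?_) hpd
    fun E hE hq => ?_
  · rw [mem_span_insert_linP_iff hj] at hs ⊢
    simp only [Set.image_pair, restrictHyp_X_succAbove, map_mul] at hs ⊢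
    rw [← Set.image_pair] at hs ⊢
    exact mem_of_X_mul_mem_span_X_image (by simp) hs
  · have hX : (X (j.succAbove 2) : PS K 4) = linP (Pi.single (j.succAbove 2) 1) := by
      simp [linP, Pi.single_apply]
    rw [hX]
    exact mem_radical_of_awayProd_mem hE
      (fun x hx hcx => hq _ (h.awayProd (hfree x hx hcx))) _

/-- The residue ideal along a hyperplane whose deletion is tame and locally free is principal. -/
theorem isPrincipal_residueIdeal {A : Arrangement K 4} {c : Fin 4 → K} {j : Fin 4}
    (hcA : c ∈ A.hyps) (hj : c j ≠ 0) (hpd : pdLE (PS K 4) 1 (logOneForms (delArr A c)))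
    (hfree : LocallyFreeAlong (delArr A c) (fun _ => 1) c) :
    Submodule.IsPrincipal (residueIdeal A c j) := by
  have hc := A.ne_zero c hcA
  by_contra hI
  obtain ⟨P, g, hP, hPg, a, haP, ha, b, hbP, hab⟩ := exists_associated_prime_of_not_isPrincipal hI
  have hcP : linP c ∈ P.comap (restrictHyp c j) := by
    rw [Ideal.mem_comap, (restrictHyp_eq_zero_iff hj).mpr dvd_rfl]
    exact P.zero_mem
  obtain h | ⟨x, hx, h⟩ := forall_linP_mem_or_exists (P.comap (restrictHyp c j))
  · have hX : ∀ i : Fin 3, (X i : PS K 3) ∈ P := by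
      intro i
      have := h (Pi.single (j.succAbove i) 1)
      rw [show linP (Pi.single (j.succAbove i) 1) = (X (j.succAbove i) : PS K 4) by
        simp [linP, Pi.single_apply], Ideal.mem_comap, restrictHyp_X_succAbove] at this
      exact this
    have h1 := (koszulExactUpTo_one_logOneForms hc hj hpd hfree).mul_mem_residueIdeal hcA hj
      (g := g) (by simp) (by simpa using (hPg _).mp (hX 0)) (by simpa using (hPg _).mp (hX 1))
    rw [map_one, ← hPg] at h1
    exact hP.ne_top ((Ideal.eq_top_iff_one P).mpr h1)
  · obtain ⟨a, rfl⟩ := restrictHyp_surjective c j a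
    obtain ⟨b, rfl⟩ := restrictHyp_surjective c j b
    have h1 := (KoszulExactUpTo.of_restrictHyp hc hj ha hab).awayProd (hfree x hx (h c hcP))
    have h2 := h1.mul_mem_residueIdeal hcA hj ha.ne_zero ((hPg _).mp haP) ((hPg _).mp hbP)
    exact awayProd_notMem h ((hPg _).mpr h2)

/-- (Yoshinaga-type criterion, case `ℓ = 4`.)  An essential arrangement `A` in `K^4` is
tame if there is `H ∈ A` such that `A ∖ {H}` is tame and locally free along `H`. -/
theorem tame_of_four_dimensional
    {K : Type} [Field K] (A : Arrangement K 4) (hess : Essential A)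
    (h : ∃ c0 ∈ A.hyps, Tame (delArr A c0) ∧
      LocallyFreeAlong (delArr A c0) (fun _ => 1) c0) :
    Tame A := by
  obtain ⟨c, hc, htame, hfree⟩ := h
  intro p hp
  obtain hp | rfl | rfl : 2 ≤ p ∨ p = 0 ∨ p = 1 := by omega
  · exact pdLE_mono hp (pdLE_two_Omega A _ p)
  · exact projective_Omega_zero A
  · obtain ⟨j, hj⟩ := Function.ne_iff.mp (A.ne_zero c hc)
    have hpd := pdLE_of_linearEquiv (logOneFormsEquiv (delArr A c)).symm (htame 1 (by norm_num))
    exact pdLE_of_linearEquiv (logOneFormsEquiv A)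
      (pdLE_one_logOneForms hc hj hpd (isPrincipal_residueIdeal hc hj hpd hfree))
end
end

section
/- Let A be a generic and irreducible essential arrangement in K^ℓ, i.e., codim_V(∩_{i=1}^{k} H_i) = k for any distinct hyperplanes H_1, …, H_k ∈ A with k ≤ ℓ−1, and A is not a product of lower-dimensional arrangements. Then for any multiplicity m : A → Z_{>0}, the multiarrangement (A,m) is tame. -/
noncomputable section
open Classical MvPolynomial

variable {K : Type} [Field K] {ℓ : ℕ}

section ProjectiveDimension

open CategoryTheory

/-- `HasPDLT R M n` : the `R`-module `M` has projective dimension less than `n`. -/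
abbrev HasPDLT (R : Type) [CommRing R] (M : Type) [AddCommGroup M] [Module R M] (n : ℕ) : Prop :=
  HasProjectiveDimensionLT (ModuleCat.of R M) n

variable {R : Type} [CommRing R] {M N L : Type} [AddCommGroup M] [Module R M]
  [AddCommGroup N] [Module R N] [AddCommGroup L] [Module R L]

theorem HasPDLT.of_equiv {n : ℕ} (e : M ≃ₗ[R] N) (h : HasPDLT R M n) : HasPDLT R N n :=
  hasProjectiveDimensionLT_of_iso e.toModuleIso n

theorem HasPDLT.mono {n k : ℕ} (h : HasPDLT R M n) (hnk : n ≤ k) : HasPDLT R M k :=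
  hasProjectiveDimensionLT_of_ge (ModuleCat.of R M) n k hnk

theorem hasPDLT_zero_of_subsingleton [Subsingleton M] : HasPDLT R M 0 :=
  (ModuleCat.isZero_of_subsingleton (ModuleCat.of R M)).hasProjectiveDimensionLT_zero

theorem hasPDLT_one_iff : HasPDLT R M 1 ↔ Module.Projective R M := by
  rw [HasPDLT, ← projective_iff_hasProjectiveDimensionLT_one, ← IsProjective.iff_projective]

theorem hasPDLT_of_projective [Module.Projective R M] {n : ℕ} (hn : 1 ≤ n) : HasPDLT R M n :=
  (hasPDLT_one_iff.2 inferInstance).mono hn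

section ShortExact

variable {f : M →ₗ[R] N} {g : N →ₗ[R] L}

theorem HasPDLT.middle (hf : Function.Injective f) (hfg : Function.Exact f g)
    (hg : Function.Surjective g) {n : ℕ}
    (hM : HasPDLT R M n) (hL : HasPDLT R L n) : HasPDLT R N n :=
  (ModuleCat.shortComplexOfConj_shortExact (.refl R M) (.refl R N) (.refl R L)
    f g hfg hf hg).hasProjectiveDimensionLT_X₂ n hM hL

theorem HasPDLT.right (hf : Function.Injective f) (hfg : Function.Exact f g)
    (hg : Function.Surjective g) {n : ℕ}
    (hM : HasPDLT R M n) (hN : HasPDLT R N (n + 1)) : HasPDLT R L (n + 1) :=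
  (ModuleCat.shortComplexOfConj_shortExact (.refl R M) (.refl R N) (.refl R L)
    f g hfg hf hg).hasProjectiveDimensionLT_X₃ n hM hN

theorem HasPDLT.left (hf : Function.Injective f) (hfg : Function.Exact f g)
    (hg : Function.Surjective g) {n : ℕ}
    (hN : HasPDLT R N n) (hL : HasPDLT R L (n + 1)) : HasPDLT R M n :=
  (ModuleCat.shortComplexOfConj_shortExact (.refl R M) (.refl R N) (.refl R L)
    f g hfg hf hg).hasProjectiveDimensionLT_X₁ n hN hL

end ShortExact

theorem HasPDLT.ker {n : ℕ} {g : N →ₗ[R] L} (hg : Function.Surjective g) (hN : HasPDLT R N n)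
    (hL : HasPDLT R L (n + 1)) : HasPDLT R (LinearMap.ker g) n :=
  HasPDLT.left (f := (LinearMap.ker g).subtype) Subtype.val_injective
    (LinearMap.exact_subtype_ker_map g) hg hN hL

theorem HasPDLT.prod {n : ℕ} (hM : HasPDLT R M n) (hN : HasPDLT R N n) : HasPDLT R (M × N) n :=
  HasPDLT.middle (f := LinearMap.inl R M N) (g := LinearMap.snd R M N) LinearMap.inl_injective
    Function.Exact.inl_snd LinearMap.snd_surjective hM hN

theorem HasPDLT.ker_of_projective [Module.Projective R L] {n : ℕ} (g : N →ₗ[R] L)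
    (hN : HasPDLT R N (n + 1)) (hL : ∀ W : Submodule R L, HasPDLT R (L ⧸ W) (n + 3)) :
    HasPDLT R (LinearMap.ker g) (n + 1) := by
  have hW : HasPDLT R (LinearMap.range g) (n + 2) :=
    HasPDLT.left (f := (LinearMap.range g).subtype) (g := (LinearMap.range g).mkQ)
      Subtype.val_injective (LinearMap.exact_subtype_mkQ _) (Submodule.mkQ_surjective _)
      (hasPDLT_of_projective (by lia)) (hL _)
  rw [← LinearMap.ker_rangeRestrict]
  exact HasPDLT.ker g.surjective_rangeRestrict hN hW

theorem HasPDLT.pdLE {n : ℕ} (h : HasPDLT R M (n + 1)) : pdLE R n M := by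
  induction n generalizing M with
  | zero => exact hasPDLT_one_iff.1 h
  | succ n ih =>
    have hs := Finsupp.linearCombination_id_surjective R M
    exact ⟨M, Finsupp.linearCombination R id, hs, ih (.ker hs (hasPDLT_of_projective (by lia)) h)⟩

end ProjectiveDimension

section GlobalDimension

open TensorProduct
open scoped Polynomial

theorem exact_baseChange {R : Type} [CommRing R] (B : Type) [CommRing B] [Algebra R B]
    {M N L : Type} [AddCommGroup M] [Module R M] [AddCommGroup N] [Module R N] [AddCommGroup L]
    [Module R L] {f : M →ₗ[R] N} {g : N →ₗ[R] L} (hfg : Function.Exact f g)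
    (hg : Function.Surjective g) : Function.Exact (f.baseChange B) (g.baseChange B) :=
  lTensor_exact B hfg hg

theorem HasPDLT.baseChange {R : Type} [CommRing R] (B : Type) [CommRing B] [Algebra R B]
    [Module.Flat R B] {M : Type} [AddCommGroup M] [Module R M] {n : ℕ}
    (h : HasPDLT R M (n + 1)) : HasPDLT B (B ⊗[R] M) (n + 1) := by
  induction n generalizing M with
  | zero =>
    have := hasPDLT_one_iff.1 h
    exact hasPDLT_one_iff.2 inferInstance
  | succ n ih =>
    have hs := Finsupp.linearCombination_id_surjective R M
    refine HasPDLT.right (f := (LinearMap.ker _).subtype.baseChange B)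
      (g := (Finsupp.linearCombination R (id : M → M)).baseChange B)
      ?_ ?_ ?_ (ih (.ker hs (hasPDLT_of_projective (by lia)) h)) (hasPDLT_of_projective (by lia))
    · exact Module.Flat.lTensor_preserves_injective_linearMap _ Subtype.val_injective
    · exact exact_baseChange B (LinearMap.exact_subtype_ker_map _) hs
    · exact LinearMap.lTensor_surjective B hs

variable {R : Type} [CommRing R] {M : Type} [AddCommGroup M] [Module R M] [Module R[X] M]
  [IsScalarTower R R[X] M]

variable (R M) in
/-- The scalar action `R[X] ⊗ M → M`. -/
def polyAct : R[X] ⊗[R] M →ₗ[R[X]] M :=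
  AlgebraTensorModule.lift ((LinearMap.lsmul R[X] M).flip.restrictScalars R).flip

@[simp]
theorem polyAct_tmul (p : R[X]) (x : M) : polyAct R M (p ⊗ₜ x) = p • x := rfl

variable (R M) in
/-- Multiplication by `X` on `M`, as an `R`-linear map. -/
def mulXLin : M →ₗ[R] M := ((LinearMap.lsmul R[X] M) Polynomial.X).restrictScalars R

variable (R M) in
/-- The endomorphism `X ⊗ 1 - 1 ⊗ X` of `R[X] ⊗ M`. -/
def polyDiff : R[X] ⊗[R] M →ₗ[R[X]] R[X] ⊗[R] M :=
  (LinearMap.lsmul R[X] (R[X] ⊗[R] M)) Polynomial.X - (mulXLin R M).baseChange R[X]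

@[simp]
theorem polyDiff_tmul (p : R[X]) (x : M) :
    polyDiff R M (p ⊗ₜ x) = (Polynomial.X * p) ⊗ₜ x - p ⊗ₜ ((Polynomial.X : R[X]) • x) := by
  simp [polyDiff, mulXLin, smul_tmul']

variable (R M) in
/-- The contracting homotopy `X ^ n ⊗ x ↦ ∑ i + j = n - 1, X ^ i ⊗ X ^ j x`. -/
def polyHomotopy : R[X] ⊗[R] M →ₗ[R] R[X] ⊗[R] M :=
  TensorProduct.lift ((Polynomial.basisMonomials R).constr R fun n ↦
    ∑ i ∈ Finset.range n, (TensorProduct.mk R R[X] M (Polynomial.X ^ i)) ∘ₗ (mulXLin R M) ^ (n - 1 - i))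

theorem mulXLin_pow_apply (n : ℕ) (x : M) : (mulXLin R M ^ n) x = (Polynomial.X ^ n : R[X]) • x := by
  induction n with
  | zero => simp
  | succ n ih => rw [pow_succ', Module.End.mul_apply, ih, pow_succ', mul_smul]; rfl

theorem polyHomotopy_tmul (n : ℕ) (x : M) : polyHomotopy R M ((Polynomial.X ^ n : R[X]) ⊗ₜ x) =
    ∑ i ∈ Finset.range n, (Polynomial.X ^ i : R[X]) ⊗ₜ ((Polynomial.X ^ (n - 1 - i) : R[X]) • x) := by
  have : (Polynomial.X ^ n : R[X]) = Polynomial.basisMonomials R n := by simp [Polynomial.X_pow_eq_monomial]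
  rw [polyHomotopy, TensorProduct.lift.tmul, this, Module.Basis.constr_basis]
  simp [mulXLin_pow_apply]

theorem polyHomotopy_polyDiff (y : R[X] ⊗[R] M) : polyHomotopy R M (polyDiff R M y) = y := by
  have : polyHomotopy R M ∘ₗ (polyDiff R M).restrictScalars R = LinearMap.id := by
    refine TensorProduct.ext (Polynomial.lhom_ext' fun n ↦ LinearMap.ext_ring (LinearMap.ext fun x ↦ ?_))
    simp only [LinearMap.compr₂ₛₗ_apply, LinearMap.comp_apply, TensorProduct.mk_apply,
      LinearMap.restrictScalars_apply, ← Polynomial.X_pow_eq_monomial, polyDiff_tmul, ← pow_succ', map_sub,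
      polyHomotopy_tmul, LinearMap.id_apply]
    rw [Finset.sum_range_succ, sub_eq_iff_eq_add, add_comm]
    congr 1
    · simp
    · refine Finset.sum_congr rfl fun i hi ↦ ?_
      have := Finset.mem_range.1 hi
      rw [smul_smul, ← pow_succ, show n + 1 - 1 - i = n - 1 - i + 1 by lia]
  exact LinearMap.congr_fun this y

theorem polyDiff_polyHomotopy (y : R[X] ⊗[R] M) :
    polyDiff R M (polyHomotopy R M y) = y - 1 ⊗ₜ polyAct R M y := by
  have : (polyDiff R M).restrictScalars R ∘ₗ polyHomotopy R M = LinearMap.id -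
      TensorProduct.mk R R[X] M 1 ∘ₗ (polyAct R M).restrictScalars R := by
    refine TensorProduct.ext (Polynomial.lhom_ext' fun n ↦ LinearMap.ext_ring (LinearMap.ext fun x ↦ ?_))
    simp only [LinearMap.compr₂ₛₗ_apply, LinearMap.comp_apply, TensorProduct.mk_apply,
      LinearMap.restrictScalars_apply, ← Polynomial.X_pow_eq_monomial, map_sum, polyDiff_tmul, ← pow_succ',
      polyHomotopy_tmul, LinearMap.id_apply, LinearMap.sub_apply, polyAct_tmul]
    have := Finset.sum_range_sub (fun i ↦ (Polynomial.X ^ i : R[X]) ⊗ₜ[R] ((Polynomial.X ^ (n - i) : R[X]) • x)) n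
    simp only [Nat.sub_self, pow_zero, one_smul, Nat.sub_zero] at this
    rw [← this]
    refine Finset.sum_congr rfl fun i hi ↦ ?_
    have := Finset.mem_range.1 hi
    rw [smul_smul, ← pow_succ', show n - (i + 1) = n - 1 - i by lia, show n - i = n - 1 - i + 1 by lia]
  exact LinearMap.congr_fun this y

theorem HasPDLT.polynomial {n : ℕ} (h : HasPDLT R M (n + 1)) : HasPDLT R[X] M (n + 2) := by
  refine HasPDLT.right (f := polyDiff R M) (g := polyAct R M)
    (Function.LeftInverse.injective polyHomotopy_polyDiff) (fun y ↦ ⟨fun hy ↦ ?_, ?_⟩)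
    (fun x ↦ ⟨1 ⊗ₜ x, by simp⟩) (h.baseChange R[X]) ((h.baseChange R[X]).mono (by lia))
  · exact ⟨polyHomotopy R M y, by simp [polyDiff_polyHomotopy, hy]⟩
  · rintro ⟨z, rfl⟩
    have : polyAct R M ∘ₗ polyDiff R M = 0 := by
      ext x
      simp
    exact LinearMap.congr_fun this z

theorem hasPDLT_mvPolynomial (K : Type) [Field K] (n : ℕ) (M : Type) [AddCommGroup M]
    [Module (MvPolynomial (Fin n) K) M] : HasPDLT (MvPolynomial (Fin n) K) M (n + 1) := by
  induction n generalizing M with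
  | zero =>
    let e := (MvPolynomial.isEmptyRingEquiv K (Fin 0))
    have : IsSemisimpleRing (MvPolynomial (Fin 0) K) := e.symm.isSemisimpleRing
    have := Module.projective_of_isSemisimpleRing (MvPolynomial (Fin 0) K) M
    exact hasPDLT_of_projective le_rfl
  | succ n ih =>
    let e := (MvPolynomial.finSuccEquiv K n).toRingEquiv
    let _ : Module (Polynomial (MvPolynomial (Fin n) K)) M := Module.compHom M e.symm.toRingHom
    let _ : Module (MvPolynomial (Fin n) K) M :=
      Module.compHom M (algebraMap _ (Polynomial (MvPolynomial (Fin n) K)))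
    have : IsScalarTower (MvPolynomial (Fin n) K) (Polynomial (MvPolynomial (Fin n) K)) M :=
      ⟨fun r p x ↦ by rw [Algebra.smul_def, mul_smul]; rfl⟩
    have h : HasPDLT (Polynomial (MvPolynomial (Fin n) K)) M (n + 2) := (ih M).polynomial
    have := RingHomInvPair.of_ringEquiv e.symm
    have := RingHomInvPair.symm (RingHomClass.toRingHom e.symm) (RingHomClass.toRingHom e.symm.symm)
    let f : M ≃ₛₗ[RingHomClass.toRingHom e.symm] M :=
      { AddEquiv.refl M with map_smul' := fun _ _ ↦ rfl }
    exact ModuleCat.hasProjectiveDimensionLE_of_semiLinearEquiv (M := .of _ M) (N := .of _ M)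
      e.symm f (n + 1)

end GlobalDimension

section Forms

variable {m : (Fin ℓ → K) → ℕ}

/-- Polynomial `(n - 1)`-forms, with the convention that there are no `(-1)`-forms. -/
def shiftForms (K : Type) [Field K] (ℓ : ℕ) : ℕ → Submodule (PS K ℓ) (ExtF K ℓ)
  | 0 => ⊥
  | n + 1 => formsP K ℓ n

/-- Left exterior multiplication by `dα`. -/
def wedge (c : Fin ℓ → K) : ExtF K ℓ →ₗ[PS K ℓ] ExtF K ℓ :=
  LinearMap.mulLeft (PS K ℓ) (dP c)

theorem wedge_apply (c : Fin ℓ → K) (x : ExtF K ℓ) : wedge c x = dP c * x := rfl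

@[simp]
theorem wedge_wedge_self (c : Fin ℓ → K) (x : ExtF K ℓ) : wedge c (wedge c x) = 0 := by
  rw [wedge_apply, wedge_apply, ← mul_assoc, dP, ExteriorAlgebra.ι_sq_zero, zero_mul]

theorem wedge_wedge (c t : Fin ℓ → K) (x : ExtF K ℓ) :
    wedge c (wedge t x) = wedge t (-wedge c x) := by
  rw [wedge_apply, wedge_apply, wedge_apply, wedge_apply, mul_neg, ← mul_assoc, ← mul_assoc,
    ← neg_mul]
  congr 1
  exact eq_neg_of_add_eq_zero_left (ExteriorAlgebra.ι_add_mul_swap _ _)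

theorem wedge_mem_shiftForms {n : ℕ} (c : Fin ℓ → K) {x : ExtF K ℓ}
    (hx : x ∈ shiftForms K ℓ n) : wedge c x ∈ shiftForms K ℓ (n + 1) := by
  cases n with
  | zero =>
    rw [(Submodule.mem_bot _).1 hx, map_zero]
    exact zero_mem _
  | succ n =>
    rw [shiftForms, formsP, pow_succ']
    exact Submodule.mul_mem_mul (LinearMap.mem_range_self _ _) hx

instance (n : ℕ) : Module.Free (PS K ℓ) (shiftForms K ℓ n) := by
  cases n with
  | zero => exact inferInstanceAs (Module.Free _ (⊥ : Submodule (PS K ℓ) (ExtF K ℓ)))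
  | succ n => exact inferInstanceAs (Module.Free _ (⋀[PS K ℓ]^n (Fin ℓ → PS K ℓ)))

/-- Contraction of forms with the constant vector field with coefficient vector `u`. -/
def contract (u : Fin ℓ → K) : ExtF K ℓ →ₗ[PS K ℓ] ExtF K ℓ :=
  CliffordAlgebra.contractLeft (Q := 0) (∑ i, (C (u i) : PS K ℓ) • LinearMap.proj i)

theorem contract_ι_mul (u : Fin ℓ → K) (a : Fin ℓ → PS K ℓ) (x : ExtF K ℓ) :
    contract u (ExteriorAlgebra.ι (PS K ℓ) a * x) =
      (∑ i, C (u i) * a i) • x - ExteriorAlgebra.ι (PS K ℓ) a * contract u x := by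
  rw [contract]
  refine (CliffordAlgebra.contractLeft_ι_mul _ _ _).trans ?_
  simp

theorem contract_wedge (u c : Fin ℓ → K) (x : ExtF K ℓ) :
    contract u (wedge c x) = (C (∑ i, u i * c i) : PS K ℓ) • x - wedge c (contract u x) := by
  rw [wedge_apply, dP, contract_ι_mul]
  simp [wedge_apply, dP]

theorem contract_mem_shiftForms {n : ℕ} (u : Fin ℓ → K) {x : ExtF K ℓ}
    (hx : x ∈ shiftForms K ℓ (n + 1)) : contract u x ∈ shiftForms K ℓ n := by
  induction n generalizing x with
  | zero =>
    rw [shiftForms, formsP, pow_zero, Submodule.mem_one] at hx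
    obtain ⟨f, rfl⟩ := hx
    exact (Submodule.mem_bot _).2 (CliffordAlgebra.contractLeft_algebraMap _ _ f)
  | succ n ih =>
    rw [shiftForms, formsP, pow_succ'] at hx
    refine Submodule.mul_induction_on hx ?_ fun x y hx hy ↦ ?_
    · rintro _ ⟨a, rfl⟩ x hx
      rw [contract_ι_mul]
      refine sub_mem (Submodule.smul_mem _ _ hx) ?_
      cases n with
      | zero =>
        rw [(Submodule.mem_bot _).1 (ih hx), mul_zero]
        exact zero_mem _
      | succ n =>
        rw [shiftForms, formsP, pow_succ']
        exact Submodule.mul_mem_mul (LinearMap.mem_range_self _ _) (ih hx)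
    · rw [map_add]
      exact add_mem hx hy

/-- The power `α ^ m(H)` of a defining form. -/
def linPow (m : (Fin ℓ → K) → ℕ) (c : Fin ℓ → K) : PS K ℓ := linP c ^ m c

/-- The ideal generated by `α ^ m(H)` for `H` in `T`. -/
def powIdeal (m : (Fin ℓ → K) → ℕ) (T : Finset (Fin ℓ → K)) : Ideal (PS K ℓ) :=
  Ideal.span (linPow m '' T)

theorem powIdeal_insert (c : Fin ℓ → K) (T : Finset (Fin ℓ → K)) :
    powIdeal m (insert c T) = Ideal.span {linPow m c} ⊔ powIdeal m T := by
  rw [powIdeal, Finset.coe_insert, Set.image_insert_eq, Ideal.span_insert, powIdeal]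

/-- The submodule `I F_n + ∑_{t ∈ T} dα_t ∧ F_{n-1}` attached to a sequence `F` of modules of
forms. -/
def koszulSub (F : ℕ → Submodule (PS K ℓ) (ExtF K ℓ)) (I : Ideal (PS K ℓ))
    (T : Finset (Fin ℓ → K)) (n : ℕ) : Submodule (PS K ℓ) (ExtF K ℓ) :=
  I • F n ⊔ ⨆ t ∈ T, (F (n - 1)).map (wedge t)

section KoszulSub

variable {F F' : ℕ → Submodule (PS K ℓ) (ExtF K ℓ)} {I I' : Ideal (PS K ℓ)}
  {T T' : Finset (Fin ℓ → K)} {n n' : ℕ} {x : ExtF K ℓ}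

theorem koszulSub_insert (c : Fin ℓ → K) :
    koszulSub F I (insert c T) n = koszulSub F I T n ⊔ (F (n - 1)).map (wedge c) := by
  rw [koszulSub, Finset.iSup_insert, koszulSub, sup_assoc, sup_comm (Submodule.map _ _)]

theorem smul_mem_koszulSub {f : PS K ℓ} (hf : f ∈ I) (hx : x ∈ F n) : f • x ∈ koszulSub F I T n :=
  Submodule.mem_sup_left (Submodule.smul_mem_smul hf hx)

theorem wedge_mem_koszulSub {t : Fin ℓ → K} (ht : t ∈ T) (hx : x ∈ F (n - 1)) :
    wedge t x ∈ koszulSub F I T n :=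
  Submodule.mem_sup_right (Submodule.mem_iSup_of_mem t (Submodule.mem_iSup_of_mem ht
    (Submodule.mem_map_of_mem hx)))

theorem map_mem_koszulSub (φ : ExtF K ℓ →ₗ[PS K ℓ] ExtF K ℓ) (hI : I ≤ I')
    (hF : ∀ y ∈ F n, φ y ∈ F' n')
    (hT : ∀ t ∈ T, ∀ y ∈ F (n - 1), φ (wedge t y) ∈ koszulSub F' I' T' n')
    (hx : x ∈ koszulSub F I T n) : φ x ∈ koszulSub F' I' T' n' := by
  suffices koszulSub F I T n ≤ (koszulSub F' I' T' n').comap φ from this hx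
  refine sup_le (Submodule.smul_le.2 fun f hf y hy ↦ ?_) (iSup₂_le fun t ht ↦ ?_)
  · rw [Submodule.mem_comap, map_smul]
    exact smul_mem_koszulSub (hI hf) (hF y hy)
  · rintro _ ⟨y, hy, rfl⟩
    exact hT t ht y hy

theorem koszulSub_mono (hF : F ≤ F') (hI : I ≤ I') (hT : T ⊆ T') (hx : x ∈ koszulSub F I T n) :
    x ∈ koszulSub F' I' T' n :=
  map_mem_koszulSub LinearMap.id hI (fun _ hy ↦ hF n hy)
    (fun _ ht _ hy ↦ wedge_mem_koszulSub (hT ht) (hF _ hy)) hx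

end KoszulSub

end Forms

section Independence

variable {m : (Fin ℓ → K) → ℕ}

theorem MvPolynomial.mem_of_X_mul_mem_span_X_pow {σ : Type} {i : σ} {s : Set σ} (hi : i ∉ s)
    (e : σ → ℕ) {f : MvPolynomial σ K}
    (hf : X i * f ∈ Ideal.span ((fun j ↦ (X j ^ e j : MvPolynomial σ K)) '' s)) :
    f ∈ Ideal.span ((fun j ↦ (X j ^ e j : MvPolynomial σ K)) '' s) := by
  have hs : (fun j ↦ (X j ^ e j : MvPolynomial σ K)) '' s =
      (fun d ↦ monomial d (1 : K)) '' ((fun j ↦ Finsupp.single j (e j)) '' s) := by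
    rw [Set.image_image]
    simp only [X_pow_eq_monomial]
  rw [hs, mem_ideal_span_monomial_image] at hf ⊢
  intro d hd
  obtain ⟨_, ⟨j, hj, rfl⟩, hle⟩ := hf (Finsupp.single i 1 + d) (by
    rw [support_X_mul]
    exact Finset.mem_map_of_mem (addLeftEmbedding _) hd)
  refine ⟨_, ⟨j, hj, rfl⟩, ?_⟩
  have hij : i ≠ j := fun h ↦ hi (h ▸ hj)
  have := hle j
  rw [Finsupp.single_le_iff]
  simpa [hij] using this

variable (K ℓ) in
/-- Coefficient vectors to linear polynomials, as a linear map. -/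
def linPHom : (Fin ℓ → K) →ₗ[K] PS K ℓ :=
  ∑ i, (LinearMap.toSpanSingleton K (PS K ℓ) (X i)) ∘ₗ LinearMap.proj i

theorem linPHom_apply (c : Fin ℓ → K) : linPHom K ℓ c = linP c := by
  simp [linPHom, linP, smul_eq_C_mul]

theorem linPHom_single (i : Fin ℓ) : linPHom K ℓ (Pi.single i 1) = X i := by
  rw [linPHom_apply, linP, Finset.sum_eq_single i] <;> simp +contextual

/-- The linear change of coordinates attached to a basis of the space of linear forms. -/
def coordEquiv {ι : Type} (b : Module.Basis ι K (Fin ℓ → K)) :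
    MvPolynomial ι K ≃ₐ[K] PS K ℓ :=
  AlgEquiv.ofAlgHom (aeval fun i ↦ linP (b i))
    (aeval fun i ↦ b.constr K (X : ι → MvPolynomial ι K) (Pi.single i 1))
    (by
      refine algHom_ext fun i ↦ ?_
      have : ((aeval fun i ↦ linP (b i) : MvPolynomial ι K →ₐ[K] PS K ℓ).toLinearMap ∘ₗ
          b.constr K (X : ι → MvPolynomial ι K)) = linPHom K ℓ :=
        b.ext fun j ↦ by simp [linPHom_apply]
      simpa [linPHom_single] using LinearMap.congr_fun this (Pi.single i 1))
    (by
      refine algHom_ext fun i ↦ ?_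
      have : ((aeval fun i ↦ b.constr K (X : ι → MvPolynomial ι K) (Pi.single i 1) :
          PS K ℓ →ₐ[K] MvPolynomial ι K).toLinearMap ∘ₗ linPHom K ℓ) = b.constr K X :=
        LinearMap.pi_ext' fun j ↦ LinearMap.ext_ring (by simp [linPHom_single])
      simpa [linPHom_apply] using LinearMap.congr_fun this (b i))

theorem coordEquiv_X {ι : Type} (b : Module.Basis ι K (Fin ℓ → K)) (i : ι) :
    coordEquiv b (X i) = linP (b i) := by
  simp [coordEquiv]

/-- The vectors of a finite set are linearly independent. -/
abbrev Indep (s : Finset (Fin ℓ → K)) : Prop :=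
  LinearIndependent K (fun x : {c // c ∈ s} => (x : Fin ℓ → K))

theorem mem_powIdeal_of_linP_mul_mem {c : Fin ℓ → K} {T : Finset (Fin ℓ → K)} (hc : c ∉ T)
    (h : Indep (insert c T)) {f : PS K ℓ} (hf : linP c * f ∈ powIdeal m T) :
    f ∈ powIdeal m T := by
  have h' : LinearIndepOn K id ((insert c T : Finset (Fin ℓ → K)) : Set (Fin ℓ → K)) := h
  let b := Module.Basis.extend h'
  have hmem (x) (hx : x ∈ insert c T) : x ∈ h'.extend (Set.subset_univ _) :=
    h'.subset_extend _ hx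
  let i : h'.extend (Set.subset_univ _) := ⟨c, hmem c (Finset.mem_insert_self _ _)⟩
  let s : Set (h'.extend (Set.subset_univ _)) := {x | (x : Fin ℓ → K) ∈ T}
  have hb (x) : b x = x := Module.Basis.extend_apply_self h' x
  have hI : powIdeal m T = (Ideal.span ((fun j : h'.extend (Set.subset_univ _) ↦
      (X j ^ m j : MvPolynomial (h'.extend (Set.subset_univ _)) K)) '' s)).map (coordEquiv b) := by
    rw [Ideal.map_span, powIdeal, Set.image_image]
    congr 1
    ext f
    simp only [map_pow, coordEquiv_X, hb, linPow]
    constructor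
    · rintro ⟨t, ht, rfl⟩
      exact ⟨⟨t, hmem t (Finset.mem_insert_of_mem ht)⟩, ht, rfl⟩
    · rintro ⟨t, ht, rfl⟩
      exact ⟨t, ht, rfl⟩
  have hX : linP c * f = coordEquiv b (X i * (coordEquiv b).symm f) := by
    rw [map_mul, coordEquiv_X, hb, AlgEquiv.apply_symm_apply]
  rw [hI] at hf ⊢
  rw [hX, Ideal.mem_map_of_equiv] at hf
  rw [Ideal.mem_map_of_equiv]
  obtain ⟨g, hg, hgf⟩ := hf
  rw [EmbeddingLike.apply_eq_iff_eq] at hgf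
  rw [hgf] at hg
  exact ⟨_, mem_of_X_mul_mem_span_X_pow (i := i) (s := s) hc _ hg, by simp⟩

theorem mem_powIdeal_of_linPow_mul_mem {c : Fin ℓ → K} {T : Finset (Fin ℓ → K)} (hc : c ∉ T)
    (h : Indep (insert c T)) {f : PS K ℓ} (hf : linPow m c * f ∈ powIdeal m T) :
    f ∈ powIdeal m T := by
  rw [linPow] at hf
  generalize m c = n at hf
  induction n with
  | zero => rwa [pow_zero, one_mul] at hf
  | succ n ih =>
    rw [pow_succ', mul_assoc] at hf
    exact ih (mem_powIdeal_of_linP_mul_mem hc h hf)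

theorem exists_separating_vector {c : Fin ℓ → K} {T : Finset (Fin ℓ → K)} (hc : c ∉ T)
    (h : Indep (insert c T)) :
    ∃ u : Fin ℓ → K, ∑ i, u i * c i = 1 ∧ ∀ t ∈ T, ∑ i, u i * t i = 0 := by
  have h' : LinearIndepOn K id ((insert c T : Finset (Fin ℓ → K)) : Set (Fin ℓ → K)) := h
  rw [Finset.coe_insert, linearIndepOn_id_insert (by simpa using hc)] at h'
  obtain ⟨φ, hφc, hφ⟩ := Submodule.exists_dual_map_eq_bot_of_notMem h'.2 inferInstance
  have hsum (x : Fin ℓ → K) : ∑ i, φ (Pi.single i 1) * x i = φ x := by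
    conv_rhs => rw [← Finset.univ_sum_single x, map_sum]
    refine Finset.sum_congr rfl fun i _ ↦ ?_
    rw [mul_comm, ← smul_eq_mul, ← map_smul, ← Pi.single_smul, smul_eq_mul, mul_one]
  refine ⟨fun i ↦ (φ c)⁻¹ * φ (Pi.single i 1), ?_, fun t ht ↦ ?_⟩
  · simp only [mul_assoc, ← Finset.mul_sum, hsum]
    exact inv_mul_cancel₀ hφc
  · simp only [mul_assoc, ← Finset.mul_sum, hsum]
    have : φ t ∈ (Submodule.span K (T : Set (Fin ℓ → K))).map φ :=
      Submodule.mem_map_of_mem (Submodule.subset_span ht)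
    rw [hφ, Submodule.mem_bot] at this
    rw [this, mul_zero]

theorem mem_koszulSub_insert_of_wedge_mem {I : Ideal (PS K ℓ)} {c : Fin ℓ → K}
    {T : Finset (Fin ℓ → K)} (hc : c ∉ T) (h : Indep (insert c T)) {n : ℕ} {x : ExtF K ℓ}
    (hx : x ∈ shiftForms K ℓ n) (hcx : wedge c x ∈ koszulSub (shiftForms K ℓ) I T (n + 1)) :
    x ∈ koszulSub (shiftForms K ℓ) I (insert c T) n := by
  obtain ⟨u, huc, hu⟩ := exists_separating_vector hc h
  have hpred {y : ExtF K ℓ} (hy : y ∈ shiftForms K ℓ n) :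
      contract u y ∈ shiftForms K ℓ (n - 1) := by
    cases n with
    | zero =>
      rw [(Submodule.mem_bot _).1 hy, map_zero]
      exact zero_mem _
    | succ n => exact contract_mem_shiftForms u hy
  have hx' : x = wedge c (contract u x) + contract u (wedge c x) := by
    rw [contract_wedge, huc]
    simp
  rw [hx']
  refine add_mem (wedge_mem_koszulSub (Finset.mem_insert_self _ _) (hpred hx)) ?_
  refine map_mem_koszulSub (contract u) le_rfl (fun y hy ↦ contract_mem_shiftForms u hy)
    (fun t ht y hy ↦ ?_) hcx
  rw [contract_wedge, hu t ht, C_0, zero_smul, zero_sub, ← map_neg]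
  exact wedge_mem_koszulSub (Finset.mem_insert_of_mem ht) (neg_mem (hpred hy))

theorem Submodule.mem_smul_of_smul_mem {R M : Type} [CommRing R] [AddCommGroup M] [Module R M]
    {I : Ideal R} (N : Submodule R M) [Module.Free R N] {a : R} (ha : ∀ f, a * f ∈ I → f ∈ I)
    {x : M} (hx : x ∈ N) (hax : a • x ∈ I • N) : x ∈ I • N := by
  let b := Module.Free.chooseBasis R N
  have key (φ : N →ₗ[R] R) (y : N) (hy : y ∈ I • (⊤ : Submodule R N)) : φ y ∈ I := by
    refine Submodule.smul_induction_on hy (fun r hr z _ ↦ ?_) fun y z hy hz ↦ ?_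
    · rw [map_smul]
      exact I.mul_mem_right _ hr
    · rw [map_add]
      exact add_mem hy hz
  have hx' : a • (⟨x, hx⟩ : N) ∈ I • (⊤ : Submodule R N) :=
    (Submodule.mem_smul_top_iff I N _).2 hax
  refine (Submodule.mem_smul_top_iff I N ⟨x, hx⟩).1 ?_
  rw [← b.linearCombination_repr ⟨x, hx⟩, Finsupp.linearCombination_apply]
  refine sum_mem fun i _ ↦ Submodule.smul_mem_smul (ha _ ?_) trivial
  have := key (b.coord i) _ hx'
  rwa [map_smul] at this

theorem mem_koszulSub_of_smul_mem {I : Ideal (PS K ℓ)} {a : PS K ℓ}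
    (ha : ∀ f, a * f ∈ I → f ∈ I) {T : Finset (Fin ℓ → K)} (h : Indep T) {n : ℕ}
    {x : ExtF K ℓ} (hx : x ∈ shiftForms K ℓ n)
    (hax : a • x ∈ koszulSub (shiftForms K ℓ) I T n) :
    x ∈ koszulSub (shiftForms K ℓ) I T n := by
  induction T using Finset.induction_on generalizing n x with
  | empty =>
    simp only [koszulSub, Finset.notMem_empty, iSup_false, iSup_bot, sup_bot_eq] at hax ⊢
    exact Submodule.mem_smul_of_smul_mem _ ha hx hax
  | insert t T ht ih =>
    have hT : Indep T := LinearIndepOn.mono (v := id) h (Finset.coe_subset.2 (Finset.subset_insert _ _))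
    refine mem_koszulSub_insert_of_wedge_mem ht h hx
      (ih hT (wedge_mem_shiftForms t hx) ?_)
    rw [← map_smul]
    refine map_mem_koszulSub (wedge t) le_rfl (fun y hy ↦ wedge_mem_shiftForms t hy)
      (fun s hs y hy ↦ ?_) hax
    obtain rfl | hs := Finset.mem_insert.1 hs
    · rw [wedge_wedge_self]
      exact zero_mem _
    · rw [wedge_wedge]
      cases n with
      | zero =>
        rw [(Submodule.mem_bot _).1 hy]
        simp
      | succ n => exact wedge_mem_koszulSub hs (neg_mem (wedge_mem_shiftForms t hy))

end Independence

section LogForms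

variable {m : (Fin ℓ → K) → ℕ}

/-- Logarithmic `(n - 1)`-forms (multiplied by the defining polynomial) of a finite set of
linear forms. -/
def shiftOmega (m : (Fin ℓ → K) → ℕ) (A : Finset (Fin ℓ → K)) (n : ℕ) :
    Submodule (PS K ℓ) (ExtF K ℓ) :=
  shiftForms K ℓ n ⊓ ⨅ c ∈ A, Submodule.comap (wedge c)
    (Submodule.map (LinearMap.lsmul (PS K ℓ) (ExtF K ℓ) (linPow m c)) (shiftForms K ℓ (n + 1)))

variable {A T : Finset (Fin ℓ → K)} {b c : Fin ℓ → K} {n : ℕ} {x : ExtF K ℓ}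

theorem mem_shiftOmega : x ∈ shiftOmega m A n ↔
    x ∈ shiftForms K ℓ n ∧ ∀ c ∈ A, ∃ y ∈ shiftForms K ℓ (n + 1), linPow m c • y = wedge c x := by
  simp [shiftOmega, Submodule.mem_iInf]

theorem shiftOmega_le : shiftOmega m A ≤ shiftForms K ℓ := fun _ ↦ inf_le_left

theorem mem_shiftOmega_insert : x ∈ shiftOmega m (insert b A) n ↔
    x ∈ shiftOmega m A n ∧ ∃ y ∈ shiftForms K ℓ (n + 1), linPow m b • y = wedge b x := by
  simp only [mem_shiftOmega, Finset.forall_mem_insert]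
  tauto

theorem shiftOmega_zero (hx : x ∈ shiftOmega m A 0) : x = 0 :=
  (Submodule.mem_bot _).1 (shiftOmega_le 0 hx)

theorem shiftOmega_empty : shiftOmega m ∅ n = shiftForms K ℓ n := by
  simp [shiftOmega]

theorem wedge_mem_shiftOmega (c : Fin ℓ → K) (hx : x ∈ shiftOmega m A n) :
    wedge c x ∈ shiftOmega m A (n + 1) := by
  rw [mem_shiftOmega] at hx ⊢
  refine ⟨wedge_mem_shiftForms c hx.1, fun t ht ↦ ?_⟩
  obtain ⟨y, hy, hyx⟩ := hx.2 t ht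
  refine ⟨-wedge c y, neg_mem (wedge_mem_shiftForms c hy), ?_⟩
  rw [wedge_wedge, ← hyx, map_neg, map_smul, smul_neg]

theorem wedge_mem_shiftOmega_insert (hx : x ∈ shiftOmega m A n) :
    wedge b x ∈ shiftOmega m (insert b A) (n + 1) :=
  mem_shiftOmega_insert.2 ⟨wedge_mem_shiftOmega b hx, 0, zero_mem _, by simp⟩

theorem wedge_mem_shiftOmega_insert_pred (hx : x ∈ shiftOmega m A (n - 1)) :
    wedge b x ∈ shiftOmega m (insert b A) n := by
  cases n with
  | zero => simp [shiftOmega_zero hx]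
  | succ n => exact wedge_mem_shiftOmega_insert hx

theorem linPow_smul_mem_shiftOmega_insert (hx : x ∈ shiftOmega m A n) :
    linPow m b • x ∈ shiftOmega m (insert b A) n :=
  mem_shiftOmega_insert.2 ⟨Submodule.smul_mem _ _ hx, wedge b x,
    wedge_mem_shiftForms b (shiftOmega_le n hx), by rw [map_smul]⟩

theorem Indep.mono {s t : Finset (Fin ℓ → K)} (h : Indep t) (hst : s ⊆ t) : Indep s :=
  LinearIndepOn.mono (v := id) h (Finset.coe_subset.2 hst)

theorem powIdeal_mono (h : A ⊆ T) : powIdeal m A ≤ powIdeal m T :=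
  Ideal.span_mono (Set.image_mono (Finset.coe_subset.2 h))

theorem linPow_mem_powIdeal (hc : c ∈ T) : linPow m c ∈ powIdeal m T :=
  Ideal.subset_span ⟨c, hc, rfl⟩

theorem exists_of_mem_koszulSub_powIdeal_insert
    {F : ℕ → Submodule (PS K ℓ) (ExtF K ℓ)} {U : Finset (Fin ℓ → K)}
    (hx : x ∈ koszulSub F (powIdeal m (insert b U)) (insert b T) n) :
    ∃ y ∈ koszulSub F (powIdeal m U) T n, ∃ u ∈ F n, ∃ w ∈ F (n - 1),
      x = y + linPow m b • u + wedge b w := by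
  rw [koszulSub_insert] at hx
  obtain ⟨z, hz, _, ⟨w, hw, rfl⟩, rfl⟩ := Submodule.mem_sup.1 hx
  rw [koszulSub, powIdeal_insert, Submodule.sup_smul, Submodule.ideal_span_singleton_smul,
    sup_assoc] at hz
  obtain ⟨_, ⟨u, hu, rfl⟩, y, hy, rfl⟩ := Submodule.mem_sup.1 hz
  exact ⟨y, hy, u, hu, w, hw, by rw [add_comm y]; rfl⟩

theorem mem_koszulSub_shiftOmega (r : ℕ) (hAT : Disjoint A T) (hcA : c ∉ A) (hcT : c ∉ T)
    (hli : ∀ s ⊆ insert c (A ∪ T), s.card ≤ r → Indep s) (hr : T.card + n + 1 ≤ r)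
    (hx : x ∈ shiftOmega m A n)
    (hcx : wedge c x ∈ koszulSub (shiftForms K ℓ) (powIdeal m (insert c T)) T (n + 1)) :
    x ∈ koszulSub (shiftOmega m A) (powIdeal m (insert c T)) (insert c T) n := by
  induction A using Finset.induction_on generalizing T c n x with
  | empty =>
    have h : Indep (insert c T) := hli _ (by simp) (by rw [Finset.card_insert_of_notMem hcT]; lia)
    have := mem_koszulSub_insert_of_wedge_mem hcT h (shiftOmega_le n hx) hcx
    rwa [show shiftOmega m ∅ = shiftForms K ℓ from funext fun _ ↦ shiftOmega_empty]
  | insert b A hbA ih =>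
    cases n with
    | zero =>
      rw [shiftOmega_zero hx]
      exact zero_mem _
    | succ n =>
    rw [Finset.disjoint_insert_left] at hAT
    rw [Finset.mem_insert, not_or] at hcA
    have hbc : b ≠ c := fun h ↦ hcA.1 h.symm
    have hbcT : b ∉ insert c T := by simp [hbc, hAT.1]
    have hcbT : c ∉ insert b T := by simp [hcA.1, hcT]
    have hind : Indep (insert b (insert c T)) := by
      refine hli _ (fun s ↦ by simp only [Finset.mem_insert, Finset.mem_union]; tauto) ?_
      rw [Finset.card_insert_of_notMem hbcT, Finset.card_insert_of_notMem hcT]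
      lia
    have hxA := (mem_shiftOmega_insert.1 hx).1
    obtain ⟨x', hx', hxx'⟩ := (mem_shiftOmega_insert.1 hx).2
    have hdec := ih (T := ∅) (c := b) (n := n + 1) (x := x) (by simp) hbA (by simp)
      (fun s hs ↦ hli s (hs.trans fun s ↦ by simp; tauto)) (by simp; lia) hxA
      (by
        rw [← hxx']
        exact smul_mem_koszulSub (linPow_mem_powIdeal (by simp)) hx')
    obtain ⟨j₀, hj₀, y, hy, z, hz, hxyz⟩ := exists_of_mem_koszulSub_powIdeal_insert hdec
    have hj₀ : j₀ = 0 := by simpa [koszulSub, powIdeal] using hj₀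
    rw [hj₀, zero_add] at hxyz
    rw [Nat.add_sub_cancel] at hz
    have hbcz : wedge b (wedge c z) ∈
        koszulSub (shiftForms K ℓ) (powIdeal m (insert b (insert c T))) T (n + 1 + 1) := by
      have h1 : wedge b (wedge c z) = linPow m b • wedge c y - wedge c x := by
        rw [hxyz, map_add, map_smul, wedge_wedge c b, map_neg]
        abel
      rw [h1]
      refine sub_mem (smul_mem_koszulSub (linPow_mem_powIdeal (by simp))
        (wedge_mem_shiftForms c (shiftOmega_le _ hy))) ?_
      exact koszulSub_mono le_rfl (powIdeal_mono (Finset.subset_insert _ _)) subset_rfl hcx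
    have hcz := mem_koszulSub_insert_of_wedge_mem hAT.1
      (hind.mono (Finset.insert_subset_insert _ (Finset.subset_insert _ _)))
      (wedge_mem_shiftForms c (shiftOmega_le _ hz)) hbcz
    have hz' := ih (T := insert b T) (c := c) (n := n) (x := z)
      (by simp [hbA, hAT.2]) hcA.2 hcbT
      (fun s hs ↦ hli s (hs.trans fun s ↦ by simp))
      (by rw [Finset.card_insert_of_notMem hAT.1]; lia) hz
      (by rwa [Finset.insert_comm])
    rw [Finset.insert_comm] at hz'
    obtain ⟨j, hj, u, hu, w, hw, hzj⟩ := exists_of_mem_koszulSub_powIdeal_insert hz'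
    have hbj : wedge b j ∈ koszulSub (shiftOmega m (insert b A)) (powIdeal m (insert c T))
        (insert c T) (n + 1) := by
      refine map_mem_koszulSub (wedge b) le_rfl (fun y hy ↦ wedge_mem_shiftOmega_insert hy)
        (fun t ht y hy ↦ ?_) hj
      rw [wedge_wedge]
      exact wedge_mem_koszulSub ht (neg_mem (wedge_mem_shiftOmega_insert_pred hy))
    have hxj : x = linPow m b • (y + wedge b u) + wedge b j := by
      rw [hxyz, hzj]
      simp only [map_add, map_smul, wedge_wedge_self, smul_add]
      abel
    have hy' : y + wedge b u ∈ shiftOmega m A (n + 1) := add_mem hy (wedge_mem_shiftOmega b hu)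
    generalize y + wedge b u = y' at hxj hy'
    have hcy' : wedge c y' ∈ koszulSub (shiftForms K ℓ) (powIdeal m (insert c T)) T (n + 1 + 1) := by
      refine mem_koszulSub_of_smul_mem (fun f ↦ mem_powIdeal_of_linPow_mul_mem hbcT hind)
        (hind.mono fun s ↦ by simp; tauto) (wedge_mem_shiftForms c (shiftOmega_le _ hy')) ?_
      have h1 : linPow m b • wedge c y' = wedge c x - wedge c (wedge b j) := by
        rw [hxj, map_add, map_smul, add_sub_cancel_right]
      rw [h1]
      refine sub_mem hcx ?_
      refine map_mem_koszulSub (wedge c) le_rfl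
        (fun y hy ↦ wedge_mem_shiftForms c (shiftOmega_le _ hy)) (fun t ht y hy ↦ ?_) hbj
      obtain rfl | ht := Finset.mem_insert.1 ht
      · rw [wedge_wedge_self]
        exact zero_mem _
      · rw [wedge_wedge]
        exact wedge_mem_koszulSub ht (neg_mem (wedge_mem_shiftForms c (shiftOmega_le _ hy)))
    have hy'' := ih hAT.2 hcA.2 hcT (fun s hs ↦ hli s (hs.trans fun s ↦ by simp; tauto)) hr hy' hcy'
    rw [hxj]
    refine add_mem ?_ hbj
    refine map_mem_koszulSub (LinearMap.lsmul _ _ (linPow m b)) le_rfl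
      (fun y hy ↦ linPow_smul_mem_shiftOmega_insert hy) (fun t ht y hy ↦ ?_) hy''
    rw [LinearMap.lsmul_apply, ← map_smul]
    exact wedge_mem_koszulSub ht (linPow_smul_mem_shiftOmega_insert hy)

theorem exists_of_mem_shiftOmega_insert (hbA : b ∉ A)
    (hli : ∀ s ⊆ insert b A, s.card ≤ n + 1 → Indep s) (hx : x ∈ shiftOmega m (insert b A) n) :
    ∃ y ∈ shiftOmega m A n, ∃ z ∈ shiftOmega m A (n - 1), x = linPow m b • y + wedge b z := by
  obtain ⟨hxA, x', hx', hxx'⟩ := mem_shiftOmega_insert.1 hx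
  have hdec := mem_koszulSub_shiftOmega (T := ∅) (c := b) (n + 1) (by simp) hbA (by simp)
    (by simpa using hli) (by simp) hxA (by
      rw [← hxx']
      exact smul_mem_koszulSub (linPow_mem_powIdeal (by simp)) hx')
  obtain ⟨j, hj, y, hy, z, hz, hxyz⟩ := exists_of_mem_koszulSub_powIdeal_insert hdec
  have hj : j = 0 := by simpa [koszulSub, powIdeal] using hj
  exact ⟨y, hy, z, hz, by rw [hxyz, hj, zero_add]⟩

end LogForms

section Tameness

variable {m : (Fin ℓ → K) → ℕ} {A : Finset (Fin ℓ → K)} {b : Fin ℓ → K} {n : ℕ}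

theorem linPow_ne_zero (hb : b ≠ 0) : linPow m b ≠ 0 := by
  intro h
  have hind : Indep (insert b (∅ : Finset (Fin ℓ → K))) := by
    have := LinearIndepOn.singleton (R := K) (v := id) (i := b) hb
    rwa [← Finset.coe_singleton] at this
  have := mem_powIdeal_of_linPow_mul_mem (m := m) (f := 1) (Finset.notMem_empty b) hind
    (by rw [h, zero_mul]; exact zero_mem _)
  simp [powIdeal] at this

theorem eq_of_linPow_smul_eq (hb : b ≠ 0) {y z : ExtF K ℓ} (hy : y ∈ shiftForms K ℓ n)
    (hz : z ∈ shiftForms K ℓ n) (h : linPow m b • y = linPow m b • z) : y = z := by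
  have : linPow m b • (⟨y, hy⟩ : shiftForms K ℓ n) = linPow m b • ⟨z, hz⟩ := Subtype.ext h
  exact congrArg Subtype.val (smul_right_injective _ (linPow_ne_zero hb) this)

section CoprodRestrict

variable {R E : Type} [CommRing R] [AddCommGroup E] [Module R E] {P Q Q' N : Submodule R E}
  {f g : E →ₗ[R] E}

/-- The map `(y, z) ↦ f y + g z` between submodules. -/
def coprodRestrict (hP : ∀ y ∈ P, f y ∈ N) (hQ : ∀ z ∈ Q, g z ∈ N) : P × Q →ₗ[R] N :=
  (f.restrict hP).coprod (g.restrict hQ)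

theorem coprodRestrict_apply (hP : ∀ y ∈ P, f y ∈ N) (hQ : ∀ z ∈ Q, g z ∈ N) (w : P × Q) :
    (coprodRestrict hP hQ w : E) = f w.1 + g w.2 := rfl

/-- The kernel of `(y, z) ↦ f y + g z` is the set of all `z` with `g z` in the image of `f`, as
soon as `f` is injective. -/
theorem nonempty_ker_coprodRestrict_equiv (hP : ∀ y ∈ P, f y ∈ N) (hQ : ∀ z ∈ Q, g z ∈ N)
    (hf : ∀ y ∈ P, ∀ z ∈ P, f y = f z → y = z) (hQ' : ∀ z, z ∈ Q' ↔ z ∈ Q ∧ ∃ y ∈ P, f y = g z) :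
    Nonempty (LinearMap.ker (coprodRestrict hP hQ) ≃ₗ[R] Q') := by
  have hker (w : P × Q) (hw : w ∈ LinearMap.ker (coprodRestrict hP hQ)) : f w.1 + g w.2 = 0 := by
    rw [← coprodRestrict_apply hP hQ, LinearMap.mem_ker.1 hw, Submodule.coe_zero]
  let φ : LinearMap.ker (coprodRestrict hP hQ) →ₗ[R] Q' :=
    (Q.subtype ∘ₗ LinearMap.snd _ _ _ ∘ₗ Submodule.subtype _).codRestrict _
      fun w ↦ (hQ' _).2 ⟨w.1.2.2, -w.1.1, neg_mem w.1.1.2, by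
        rw [map_neg, ← add_eq_zero_iff_neg_eq]
        exact hker w.1 w.2⟩
  have hφ' (w) : (φ w : E) = w.1.2 := rfl
  refine ⟨LinearEquiv.ofBijective φ ⟨fun w w' hw ↦ ?_, fun z ↦ ?_⟩⟩
  · have h2 : (w.1.2 : E) = w'.1.2 := by rw [← hφ' w, hw, hφ']
    have h1 := (hker w.1 w.2).trans (hker w'.1 w'.2).symm
    rw [h2, add_left_inj] at h1
    exact Subtype.ext (Prod.ext (Subtype.ext (hf _ w.1.1.2 _ w'.1.1.2 h1)) (Subtype.ext h2))
  · obtain ⟨hz, y, hy, hyz⟩ := (hQ' z).1 z.2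
    refine ⟨⟨(⟨-y, neg_mem hy⟩, ⟨z, hz⟩), Subtype.ext ?_⟩, rfl⟩
    rw [coprodRestrict_apply]
    simp [hyz]

end CoprodRestrict

theorem nonempty_ker_equiv_shiftOmega (hb : b ≠ 0) {P N : Submodule (PS K ℓ) (ExtF K ℓ)}
    (hP : ∀ y ∈ P, LinearMap.lsmul (PS K ℓ) (ExtF K ℓ) (linPow m b) y ∈ N)
    (hQ : ∀ z ∈ shiftOmega m A n, wedge b z ∈ N) (hPn : P ≤ shiftForms K ℓ (n + 1))
    (hlift : ∀ z ∈ shiftOmega m (insert b A) n, ∃ y ∈ P, linPow m b • y = wedge b z) :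
    Nonempty (LinearMap.ker (coprodRestrict hP hQ) ≃ₗ[PS K ℓ] shiftOmega m (insert b A) n) :=
  nonempty_ker_coprodRestrict_equiv hP hQ
    (fun _ hy _ hz ↦ eq_of_linPow_smul_eq hb (hPn hy) (hPn hz))
    fun z ↦ ⟨fun hz ↦ ⟨(mem_shiftOmega_insert.1 hz).1, hlift z hz⟩,
      fun ⟨hz, y, hy, hyz⟩ ↦ mem_shiftOmega_insert.2 ⟨hz, y, hPn hy, hyz⟩⟩

theorem hasPDLT_shiftOmega (h0 : ∀ c ∈ A, c ≠ 0)
    (hli : ∀ s ⊆ A, s.card ≤ n + 1 → Indep s) : HasPDLT (PS K ℓ) (shiftOmega m A n) n := by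
  induction A using Finset.induction_on generalizing n with
  | empty =>
    rw [shiftOmega_empty]
    cases n with
    | zero =>
      have : Subsingleton (shiftForms K ℓ 0) := Submodule.subsingleton_iff_eq_bot.2 rfl
      exact hasPDLT_zero_of_subsingleton
    | succ n => exact hasPDLT_of_projective (by lia)
  | insert b A hbA ih =>
    have hb := h0 b (Finset.mem_insert_self _ _)
    have hsub := Finset.subset_insert b A
    induction n with
    | zero =>
      have : Subsingleton (shiftOmega m (insert b A) 0) :=
        Submodule.subsingleton_iff_eq_bot.2 (eq_bot_iff.2 (shiftOmega_le 0))
      exact hasPDLT_zero_of_subsingleton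
    | succ n ihn =>
      have hP (y) (hy : y ∈ shiftOmega m A (n + 1)) :
          LinearMap.lsmul (PS K ℓ) (ExtF K ℓ) (linPow m b) y ∈ shiftOmega m (insert b A) (n + 1) :=
        linPow_smul_mem_shiftOmega_insert hy
      have hQ (z) (hz : z ∈ shiftOmega m A n) :
          wedge b z ∈ shiftOmega m (insert b A) (n + 1) := wedge_mem_shiftOmega_insert hz
      have hsurj : Function.Surjective (coprodRestrict hP hQ) := by
        rintro ⟨x, hx⟩
        obtain ⟨y, hy, z, hz, rfl⟩ := exists_of_mem_shiftOmega_insert hbA hli hx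
        exact ⟨(⟨y, hy⟩, ⟨z, hz⟩), rfl⟩
      have hli' (s) (hs : s ⊆ insert b A) (hcard : s.card ≤ n + 1) : Indep s :=
        hli s hs (by lia)
      have hA (c) (hc : c ∈ A) : c ≠ 0 := h0 c (hsub hc)
      obtain ⟨e⟩ : Nonempty (LinearMap.ker (coprodRestrict hP hQ) ≃ₗ[PS K ℓ]
          shiftOmega m (insert b A) n) := by
        refine nonempty_ker_equiv_shiftOmega hb hP hQ (shiftOmega_le _) fun z hz ↦ ?_
        obtain ⟨u, hu, w, hw, rfl⟩ := exists_of_mem_shiftOmega_insert hbA hli' hz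
        exact ⟨wedge b u, wedge_mem_shiftOmega b hu, by simp⟩
      have hker : HasPDLT (PS K ℓ) (LinearMap.ker (coprodRestrict hP hQ)) n :=
        .of_equiv e.symm (ihn hli')
      refine HasPDLT.right (f := (LinearMap.ker (coprodRestrict hP hQ)).subtype)
        Subtype.val_injective (LinearMap.exact_subtype_ker_map _) hsurj hker
        (.prod (ih hA fun s hs ↦ hli s (hs.trans hsub))
          ((ih hA fun s hs ↦ hli' s (hs.trans hsub)).mono (by lia)))

theorem hasPDLT_shiftOmega_top (h0 : ∀ c ∈ A, c ≠ 0) :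
    HasPDLT (PS K ℓ) (shiftOmega m A n) (ℓ - 2 + 1) := by
  induction A using Finset.induction_on with
  | empty =>
    rw [shiftOmega_empty]
    exact hasPDLT_of_projective (by lia)
  | insert b A hbA ih =>
    have hP (y) (hy : y ∈ shiftForms K ℓ (n + 1)) :
        LinearMap.lsmul (PS K ℓ) (ExtF K ℓ) (linPow m b) y ∈ shiftForms K ℓ (n + 1) :=
      Submodule.smul_mem _ _ hy
    have hQ (z) (hz : z ∈ shiftOmega m A n) : wedge b z ∈ shiftForms K ℓ (n + 1) :=
      wedge_mem_shiftForms b (shiftOmega_le _ hz)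
    obtain ⟨e⟩ := nonempty_ker_equiv_shiftOmega (h0 b (Finset.mem_insert_self _ _)) hP hQ le_rfl
      fun z hz ↦ (mem_shiftOmega_insert.1 hz).2
    exact .of_equiv e (HasPDLT.ker_of_projective _ (.prod (hasPDLT_of_projective (by lia))
      (ih fun c hc ↦ h0 c (Finset.mem_insert_of_mem hc)))
      fun W ↦ (hasPDLT_mvPolynomial K ℓ _).mono (by lia))

end Tameness

/-- A generic irreducible arrangement is tame for every multiplicity. -/
theorem multi_generic_tame
    {K : Type} [Field K] {ℓ : ℕ} (A : Arrangement K ℓ) (hess : Essential A)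
    (hgen : GenericArr A) (hirr : IrreducibleArr A)
    (m : (Fin ℓ → K) → ℕ) (hm : ∀ c ∈ A.hyps, 0 < m c) :
    TameM A m := by
  intro p _
  refine HasPDLT.pdLE (M := shiftOmega m A.hyps (p + 1)) ?_
  by_cases hp : p + 3 ≤ ℓ
  · exact hasPDLT_shiftOmega A.ne_zero fun s hs hcard ↦ hgen s hs (by lia)
  · exact (hasPDLT_shiftOmega_top A.ne_zero).mono (by lia)
end
end
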